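/- arXiv:1803.05703 — 2 statements merged into one kernel-verified Lean document; each statement's English description precedes it below -/
import Mathlib

section
/- For every ε > 0 there is a constant C = C(ε) > 0 with the following property. Let h ≥ 1 be an integer, set K = ⌊ε·h·log 4⌋, and let m, n be integers with 2^{4^h} ≤ m < n < 2^{4^{h+1}}, and let ψ: ℕ → ℝ satisfy 1/m ≤ ψ(m) ≤ 1/2 and 1/n ≤ ψ(n) ≤ 1/2. For k ≥ 1 let ψ_k be the function obtained from ψ by replacing ψ(m) with ψ(m)/e^k and ψ(n) with ψ(n)/e^k. Then ∑_{k=1}^K λ(E_m(ψ_k) ∩ E_n(ψ_k)) / (λ(E_m(ψ_k))·λ(E_n(ψ_k))) ≤ C·K. -/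
open MeasureTheory Filter Finset

/-- The set `E_n(ψ) ⊆ ℝ/ℤ`, the union over `1 ≤ a ≤ n`, `gcd(a,n)=1`, of the
intervals `((a-ψ(n))/n, (a+ψ(n))/n)` taken mod 1. -/
noncomputable def E (ψ : ℕ → ℝ) (n : ℕ) : Set UnitAddCircle :=
  ⋃ a ∈ (Finset.Icc 1 n).filter (fun a => Nat.Coprime a n),
    (fun y : ℝ => (y : UnitAddCircle)) '' Set.Ioo (((a : ℝ) - ψ n) / n) (((a : ℝ) + ψ n) / n)

/-- `W(ψ)`: points of the circle lying in infinitely many sets `E_n(ψ)`. -/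
noncomputable def W (ψ : ℕ → ℝ) : Set UnitAddCircle := {x | ∃ᶠ n in atTop, x ∈ E ψ n}

/-- `log x` understood as `max (1, log x)`. -/
noncomputable def flog (x : ℝ) : ℝ := max 1 (Real.log x)


namespace AOE

lemma zeta_fin (δ : ℝ) (hδ : 0 < δ) (N : ℕ) (hN : 1 ≤ N) :
    ∑ n ∈ Icc 1 N, (n : ℝ) ^ (-(1 + δ)) ≤ 1 + (1 - (N : ℝ) ^ (-δ)) / δ := by
  induction N, hN using Nat.le_induction with
  | base => simp
  | succ N hN ih =>
    rw [Finset.sum_Icc_succ_top (by omega)]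
    have hN0 : (0 : ℝ) < N := by exact_mod_cast hN
    have hN1 : (0 : ℝ) < (N + 1 : ℝ) := by positivity
    have key : ((N : ℝ) + 1) ^ (-(1 + δ)) ≤ ((N : ℝ) ^ (-δ) - ((N : ℝ) + 1) ^ (-δ)) / δ := by
      rw [le_div_iff₀ hδ]
      have e1 : ((N : ℝ) + 1) ^ (-(1 + δ)) = ((N : ℝ) + 1) ^ (-δ) * ((N : ℝ) + 1)⁻¹ := by
        rw [show -(1 + δ) = -δ + (-1) by ring, Real.rpow_add hN1, Real.rpow_neg_one]
      have e2 : (N : ℝ) ^ (-δ) = ((N : ℝ) + 1) ^ (-δ) * Real.exp (δ * Real.log ((N + 1) / N)) := by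
        rw [Real.rpow_def_of_pos hN0, Real.rpow_def_of_pos hN1, ← Real.exp_add,
          Real.log_div hN1.ne' hN0.ne']
        congr 1; ring
      have e3 : 1 + δ * ((N : ℝ) + 1)⁻¹ ≤ Real.exp (δ * Real.log ((N + 1) / N)) := by
        have h1 := Real.add_one_le_exp (δ * Real.log ((N + 1 : ℝ) / N))
        have h2 := Real.one_sub_inv_le_log_of_pos (x := (N + 1 : ℝ) / N) (by positivity)
        have h3 : 1 - ((N + 1 : ℝ) / N)⁻¹ = ((N : ℝ) + 1)⁻¹ := by
          field_simp; ring
        rw [h3] at h2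
        nlinarith
      rw [e1, e2]
      have := mul_le_mul_of_nonneg_left e3 (Real.rpow_nonneg hN1.le (-δ))
      nlinarith
    push_cast
    have : 1 + (1 - ((N : ℝ) + 1) ^ (-δ)) / δ = 1 + (1 - (N : ℝ) ^ (-δ)) / δ +
      ((N : ℝ) ^ (-δ) - ((N : ℝ) + 1) ^ (-δ)) / δ := by ring
    linarith

lemma zeta_finset (δ : ℝ) (hδ : 0 < δ) (s : Finset ℕ) (hs : ∀ n ∈ s, n ≠ 0) :
    ∑ n ∈ s, (n : ℝ) ^ (-(1 + δ)) ≤ 1 + 1 / δ := by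
  have hsub : s ⊆ Icc 1 (s.sup id + 1) := by
    intro n hn
    have h1 := hs n hn
    have h2 : id n ≤ s.sup id := Finset.le_sup hn
    simp at h2 ⊢; omega
  calc _ ≤ ∑ n ∈ Icc 1 (s.sup id + 1), (n : ℝ) ^ (-(1 + δ)) :=
        Finset.sum_le_sum_of_subset_of_nonneg hsub (fun i _ _ => by positivity)
    _ ≤ _ := zeta_fin δ hδ _ (by omega)
    _ ≤ _ := by
      gcongr
      have : (0 : ℝ) ≤ ((s.sup id + 1 : ℕ) : ℝ) ^ (-δ) := by positivity
      linarith

lemma euler_le (δ : ℝ) (hδ : 0 < δ) (s : Finset ℕ) (hs : ∀ p ∈ s, p.Prime) :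
    ∏ p ∈ s, (1 - (p : ℝ) ^ (-(1 + δ)))⁻¹ ≤ 1 + 1 / δ := by
  let f : ℕ →* ℝ :=
    { toFun := fun n => (n : ℝ) ^ (-(1 + δ))
      map_one' := by simp
      map_mul' := fun a b => by
        push_cast; exact Real.mul_rpow (by positivity) (by positivity) }
  have h := (EulerProduct.summable_and_hasSum_factoredNumbers_prod_filter_prime_geometric (f := f)
    (fun {p} hp => by
      change ‖(p : ℝ) ^ (-(1 + δ))‖ < 1
      rw [Real.norm_of_nonneg (by positivity)]
      exact Real.rpow_lt_one_of_one_lt_of_neg (by exact_mod_cast hp.one_lt) (by linarith)) s).2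
  rw [Finset.filter_true_of_mem hs] at h
  refine hasSum_le_of_sum_le h (fun t => ?_)
  have : ∑ i ∈ t, f i = ∑ i ∈ t.map (Function.Embedding.subtype _), (i : ℝ) ^ (-(1 + δ)) := by
    rw [Finset.sum_map]; rfl
  rw [this]
  apply zeta_finset δ hδ
  intro n hn
  simp only [Finset.mem_map, Function.Embedding.coe_subtype] at hn
  obtain ⟨a, _, rfl⟩ := hn
  exact Nat.ne_zero_of_mem_factoredNumbers a.2

open ArithmeticFunction in
lemma sum_vM (N : ℕ) (hN : 1 ≤ N) :
    ∑ d ∈ Icc 1 N, vonMangoldt d / d ≤ Real.log N + 6 := by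
  have h1 : ∑ k ∈ Icc 1 N, Real.log k = ∑ d ∈ Icc 1 N, vonMangoldt d * ((N / d : ℕ) : ℝ) := by
    simp_rw [← vonMangoldt_sum]
    rw [Finset.sum_comm' (t' := Icc 1 N) (s' := fun d => (Icc 1 N).filter (d ∣ ·))]
    · apply Finset.sum_congr rfl
      intro d hd
      rw [Finset.sum_const, nsmul_eq_mul, mul_comm]
      congr 2
      have := Nat.Ioc_filter_dvd_card_eq_div N d
      rw [← this]; rfl
    · intro x y
      simp only [Nat.mem_divisors, mem_filter, mem_Icc]
      constructor
      · rintro ⟨⟨a, b⟩, c, _⟩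
        exact ⟨⟨⟨a, b⟩, c⟩, Nat.pos_of_dvd_of_pos c a, (Nat.le_of_dvd a c).trans b⟩
      · rintro ⟨⟨⟨a, b⟩, c⟩, _⟩
        exact ⟨⟨a, b⟩, c, by omega⟩
  have h2 : ∑ k ∈ Icc 1 N, Real.log k ≤ N * Real.log N := by
    calc _ ≤ ∑ k ∈ Icc 1 N, Real.log N := by
          apply Finset.sum_le_sum
          intro k hk
          rw [mem_Icc] at hk
          exact Real.log_le_log (by exact_mod_cast hk.1) (by exact_mod_cast hk.2)
      _ = _ := by simp
  have h3 : ∑ d ∈ Icc 1 N, vonMangoldt d ≤ (Real.log 4 + 4) * N := by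
    have := Chebyshev.psi_le_const_mul_self (x := (N : ℝ)) (by positivity)
    unfold Chebyshev.psi at this
    rw [Nat.floor_natCast] at this
    exact this
  have h4 : ∑ d ∈ Icc 1 N, vonMangoldt d * ((N : ℝ) / d - 1) ≤
      ∑ d ∈ Icc 1 N, vonMangoldt d * ((N / d : ℕ) : ℝ) := by
    apply Finset.sum_le_sum
    intro d hd
    apply mul_le_mul_of_nonneg_left _ vonMangoldt_nonneg
    rw [← Nat.floor_div_eq_div (K := ℝ)]
    linarith [Nat.lt_floor_add_one ((N : ℝ) / d)]
  have h5 : ∑ d ∈ Icc 1 N, vonMangoldt d * ((N : ℝ) / d - 1) =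
      N * ∑ d ∈ Icc 1 N, vonMangoldt d / d - ∑ d ∈ Icc 1 N, vonMangoldt d := by
    rw [Finset.mul_sum, ← Finset.sum_sub_distrib]
    apply Finset.sum_congr rfl; intros; ring
  have hN0 : (0 : ℝ) < N := by exact_mod_cast hN
  have hl4 : Real.log 4 ≤ 2 := by
    have : Real.log 4 = 2 * Real.log 2 := by
      rw [show (4 : ℝ) = 2 ^ 2 by norm_num, Real.log_pow]; norm_num
    linarith [Real.log_two_lt_d9]
  have : N * ∑ d ∈ Icc 1 N, vonMangoldt d / d ≤ N * (Real.log N + 6) := by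
    nlinarith
  exact le_of_mul_le_mul_left this hN0

/-- primes up to X -/
noncomputable def pr (X : ℝ) : Finset ℕ := (Icc 1 ⌊X⌋₊).filter Nat.Prime

lemma mem_pr {X : ℝ} {p : ℕ} : p ∈ pr X ↔ p.Prime ∧ (p : ℝ) ≤ X := by
  unfold pr
  rw [mem_filter, mem_Icc]
  constructor
  · rintro ⟨⟨a, b⟩, c⟩
    exact ⟨c, (Nat.le_floor_iff' c.ne_zero).1 b⟩
  · rintro ⟨c, b⟩
    exact ⟨⟨c.one_lt.le, (Nat.le_floor_iff' c.ne_zero).2 b⟩, c⟩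

lemma sum_logp (X : ℝ) (hX : 1 ≤ X) :
    ∑ p ∈ pr X, Real.log p / p ≤ Real.log X + 6 := by
  have h1 : 1 ≤ ⌊X⌋₊ := by rwa [Nat.one_le_floor_iff]
  calc _ = ∑ p ∈ pr X, ArithmeticFunction.vonMangoldt p / p := by
        apply Finset.sum_congr rfl
        intro p hp
        rw [ArithmeticFunction.vonMangoldt_apply_prime (mem_pr.1 hp).1]
    _ ≤ ∑ d ∈ Icc 1 ⌊X⌋₊, ArithmeticFunction.vonMangoldt d / d := by
        apply Finset.sum_le_sum_of_subset_of_nonneg (Finset.filter_subset _ _)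
        intro i _ _
        exact div_nonneg ArithmeticFunction.vonMangoldt_nonneg (by positivity)
    _ ≤ _ := sum_vM _ h1
    _ ≤ _ := by
        gcongr
        exact Nat.floor_le (by linarith)

lemma sum_tele (s : Finset ℕ) (hs : ∀ p ∈ s, 2 ≤ p) :
    ∑ p ∈ s, 1 / ((p : ℝ) * (p - 1)) ≤ 1 := by
  have key : ∀ N : ℕ, 1 ≤ N → ∑ p ∈ Icc 2 N, 1 / ((p : ℝ) * (p - 1)) ≤ 1 - 1 / N := by
    intro N hN
    induction N, hN using Nat.le_induction with
    | base => simp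
    | succ N hN ih =>
      rw [Finset.sum_Icc_succ_top (by omega)]
      have hN0 : (0 : ℝ) < N := by exact_mod_cast hN
      push_cast
      have : 1 / (((N : ℝ) + 1) * (N + 1 - 1)) = 1 / N - 1 / (N + 1) := by
        rw [add_sub_cancel_right]; field_simp; ring
      rw [this]; linarith
  have hsub : s ⊆ Icc 2 (s.sup id + 1) := by
    intro n hn
    have h1 := hs n hn
    have h2 : id n ≤ s.sup id := Finset.le_sup hn
    simp at h2 ⊢; omega
  calc _ ≤ ∑ n ∈ Icc 2 (s.sup id + 1), 1 / ((n : ℝ) * (n - 1)) :=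
        Finset.sum_le_sum_of_subset_of_nonneg hsub (fun i hi _ => by
          rw [mem_Icc] at hi
          have : (2 : ℝ) ≤ i := by exact_mod_cast hi.1
          have : (0 : ℝ) ≤ (i : ℝ) - 1 := by linarith
          positivity)
    _ ≤ _ := key _ (by omega)
    _ ≤ _ := by
      have : (0 : ℝ) ≤ 1 / ((s.sup id + 1 : ℕ) : ℝ) := by positivity
      linarith

/-- the factor (1-1/p)⁻¹ -/
noncomputable def w (p : ℕ) : ℝ := (1 - 1 / (p : ℝ))⁻¹

lemma w_pos {p : ℕ} (hp : p.Prime) : 0 < w p := by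
  have : (2 : ℝ) ≤ p := by exact_mod_cast hp.two_le
  unfold w
  have : 1 / (p : ℝ) ≤ 1 / 2 := by gcongr
  apply inv_pos.2; linarith

lemma one_le_w {p : ℕ} (hp : p.Prime) : 1 ≤ w p := by
  have : (2 : ℝ) ≤ p := by exact_mod_cast hp.two_le
  unfold w
  have : 1 / (p : ℝ) ≤ 1 / 2 := by gcongr
  have : 0 ≤ 1 / (p : ℝ) := by positivity
  apply (one_le_inv₀ (by linarith)).2; linarith

lemma w_le_exp {p : ℕ} (hp : p.Prime) : w p ≤ Real.exp (1 / p + 1 / ((p : ℝ) * (p - 1))) := by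
  have h2 : (2 : ℝ) ≤ p := by exact_mod_cast hp.two_le
  have h3 : (0 : ℝ) < (p : ℝ) - 1 := by linarith
  have h0 : (0 : ℝ) < (p : ℝ) := by linarith
  have e1 : w p = 1 / ((p : ℝ) - 1) + 1 := by
    unfold w; field_simp; ring
  have e2 : 1 / (p : ℝ) + 1 / ((p : ℝ) * (p - 1)) = 1 / ((p : ℝ) - 1) := by
    field_simp; ring
  rw [e1, e2]; exact Real.add_one_le_exp _

lemma prod_w_le (s : Finset ℕ) (hs : ∀ p ∈ s, p.Prime) :
    ∏ p ∈ s, w p ≤ Real.exp (∑ p ∈ s, 1 / (p : ℝ) + 1) := by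
  calc _ ≤ ∏ p ∈ s, Real.exp (1 / p + 1 / ((p : ℝ) * (p - 1))) :=
        Finset.prod_le_prod (fun p hp => (w_pos (hs p hp)).le) (fun p hp => w_le_exp (hs p hp))
    _ = Real.exp (∑ p ∈ s, 1 / (p : ℝ) + ∑ p ∈ s, 1 / ((p : ℝ) * (p - 1))) := by
        rw [← Real.exp_sum, Finset.sum_add_distrib]
    _ ≤ _ := by
        gcongr
        exact sum_tele s (fun p hp => (hs p hp).two_le)

/-- Mertens upper bound -/
lemma mertens (X : ℝ) (hX : 1 ≤ Real.log X) (hX0 : 0 < X) :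
    ∏ p ∈ pr X, w p ≤ 2 * Real.exp 8 * Real.log X := by
  set L := Real.log X with hL
  have hL0 : 0 < L := by linarith
  have hX1 : 1 ≤ X := by
    by_contra hc
    have := Real.log_nonpos hX0.le (by linarith : X ≤ 1)
    linarith
  set δ := 1 / L with hδ
  have hδ0 : 0 < δ := by positivity
  have hp : ∀ p ∈ pr X, p.Prime := fun p hp => (mem_pr.1 hp).1
  have h1 := euler_le δ hδ0 (pr X) hp
  have h2 : Real.exp (∑ p ∈ pr X, (p : ℝ) ^ (-(1 + δ))) ≤ 1 + 1 / δ := by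
    refine le_trans ?_ h1
    rw [Real.exp_sum]
    apply Finset.prod_le_prod (fun _ _ => (Real.exp_pos _).le)
    intro p hpp
    have hlt : (p : ℝ) ^ (-(1 + δ)) < 1 :=
      Real.rpow_lt_one_of_one_lt_of_neg (by exact_mod_cast (hp p hpp).one_lt) (by linarith)
    have := Real.one_sub_le_exp_neg ((p : ℝ) ^ (-(1 + δ)))
    rw [Real.exp_neg] at this
    rw [le_inv_comm₀ (Real.exp_pos _) (by linarith)]
    exact this
  have h3 : ∑ p ∈ pr X, 1 / (p : ℝ) ≤ ∑ p ∈ pr X, (p : ℝ) ^ (-(1 + δ)) + 7 := by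
    have : ∑ p ∈ pr X, 1 / (p : ℝ) ≤
        ∑ p ∈ pr X, ((p : ℝ) ^ (-(1 + δ)) + δ * (Real.log p / p)) := by
      apply Finset.sum_le_sum
      intro p hpp
      have hp0 : (0 : ℝ) < p := by exact_mod_cast (hp p hpp).pos
      have e1 : (p : ℝ) ^ (-(1 + δ)) = Real.exp (-(δ * Real.log p)) * (1 / p) := by
        rw [show -(1 + δ) = -δ + (-1) by ring, Real.rpow_add hp0, Real.rpow_neg_one,
          Real.rpow_def_of_pos hp0]
        rw [one_div]; congr 2; ring
      have e2 := Real.add_one_le_exp (-(δ * Real.log p))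
      rw [e1]
      have e3 : 0 < 1 / (p : ℝ) := by positivity
      have e4 := mul_le_mul_of_nonneg_right e2 e3.le
      have e5 : δ * (Real.log p / p) = δ * Real.log p * (1 / p) := by ring
      rw [e5]; linarith
    rw [Finset.sum_add_distrib, ← Finset.mul_sum] at this
    have h4 := sum_logp X hX1
    have h5 : δ * ∑ p ∈ pr X, Real.log p / p ≤ 7 := by
      calc _ ≤ δ * (L + 6) := by gcongr
        _ = 1 + 6 / L := by rw [hδ]; field_simp
        _ ≤ 1 + 6 / 1 := by gcongr
        _ = 7 := by norm_num
    linarith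
  calc _ ≤ Real.exp (∑ p ∈ pr X, 1 / (p : ℝ) + 1) := prod_w_le _ hp
    _ ≤ Real.exp (∑ p ∈ pr X, (p : ℝ) ^ (-(1 + δ)) + 8) :=
        Real.exp_le_exp.2 (by linarith)
    _ = Real.exp (∑ p ∈ pr X, (p : ℝ) ^ (-(1 + δ))) * Real.exp 8 := Real.exp_add _ _
    _ ≤ (1 + 1 / δ) * Real.exp 8 := by gcongr
    _ ≤ _ := by
      have : 1 + 1 / δ ≤ 2 * L := by rw [hδ, one_div_one_div]; linarith
      nlinarith [Real.exp_pos 8]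

end AOE


namespace AOE

noncomputable def S (P : ℕ) (X : ℝ) : Finset ℕ := (Icc 1 ⌊X⌋₊).filter (fun c => Nat.Coprime c P)
noncomputable def G (P : ℕ) (X : ℝ) : ℝ := ∑ c ∈ S P X, (c : ℝ) / Nat.totient c
noncomputable def H (P : ℕ) (X : ℝ) : ℝ := ∑ c ∈ S P X, 1 / (Nat.totient c : ℝ)

lemma mem_S {P : ℕ} {X : ℝ} {c : ℕ} : c ∈ S P X ↔ 1 ≤ c ∧ (c : ℝ) ≤ X ∧ Nat.Coprime c P := by
  unfold S
  rw [mem_filter, mem_Icc]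
  constructor
  · rintro ⟨⟨a, b⟩, c⟩
    exact ⟨a, (Nat.le_floor_iff' (by omega)).1 b, c⟩
  · rintro ⟨a, b, c⟩
    exact ⟨⟨a, (Nat.le_floor_iff' (by omega)).2 b⟩, c⟩

lemma log4 : Real.log 4 ≤ 2 := by
  have : Real.log 4 = 2 * Real.log 2 := by
    rw [show (4 : ℝ) = 2 ^ 2 by norm_num, Real.log_pow]; norm_num
  linarith [Real.log_two_lt_d9]

lemma pp_tot (d : ℕ) (hd : IsPrimePow d) : d ≤ 2 * Nat.totient d := by
  obtain ⟨p, k, hp, hk, rfl⟩ := (isPrimePow_nat_iff d).1 hd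
  rw [Nat.totient_prime_pow hp hk]
  obtain ⟨j, rfl⟩ : ∃ j, k = j + 1 := ⟨k - 1, by omega⟩
  rw [Nat.add_sub_cancel, pow_succ]
  have : p ≤ 2 * (p - 1) := by have := hp.two_le; omega
  calc p ^ j * p ≤ p ^ j * (2 * (p - 1)) := Nat.mul_le_mul_left _ this
    _ = _ := by ring

open ArithmeticFunction in
lemma sieve (P : ℕ) (X : ℝ) (hX : 0 < X) : G P X * Real.log X ≤ 13 * X * H P X := by
  have step1 : ∑ c ∈ S P X, (c : ℝ) / Nat.totient c * Real.log c ≤ 12 * X * H P X := by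
    have e1 : ∀ c ∈ S P X, (c : ℝ) / Nat.totient c * Real.log c ≤
        ∑ e ∈ c.divisors, 2 * ((e : ℝ) / Nat.totient e) * vonMangoldt (c / e) := by
      intro c hc
      rw [← vonMangoldt_sum, ← Nat.sum_div_divisors c (fun i => vonMangoldt i), Finset.mul_sum]
      apply Finset.sum_le_sum
      intro e he
      rw [Nat.mem_divisors] at he
      obtain ⟨⟨d, rfl⟩, hne⟩ := he
      have he0 : 0 < e := Nat.pos_of_ne_zero (by rintro rfl; simp at hne)
      have hd0 : 0 < d := Nat.pos_of_ne_zero (by rintro rfl; simp at hne)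
      rw [Nat.mul_div_cancel_left _ he0]
      by_cases hpp : IsPrimePow d
      · apply mul_le_mul_of_nonneg_right _ vonMangoldt_nonneg
        have h1 : (d : ℝ) ≤ 2 * Nat.totient d := by exact_mod_cast pp_tot d hpp
        have h2 : (Nat.totient e : ℝ) * Nat.totient d ≤ Nat.totient (e * d) := by
          exact_mod_cast Nat.totient_super_multiplicative e d
        have h3 : (0 : ℝ) < Nat.totient e := by exact_mod_cast Nat.totient_pos.2 he0
        have h4 : (0 : ℝ) < Nat.totient d := by exact_mod_cast Nat.totient_pos.2 hd0
        have h5 : (0 : ℝ) < e := by exact_mod_cast he0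
        calc ((e * d : ℕ) : ℝ) / Nat.totient (e * d) ≤
            ((e * d : ℕ) : ℝ) / (Nat.totient e * Nat.totient d) := by gcongr
          _ ≤ (e * (2 * Nat.totient d)) / (Nat.totient e * Nat.totient d) := by
              push_cast; gcongr
          _ = _ := by field_simp
      · rw [vonMangoldt_eq_zero_iff.2 hpp]; simp
    refine (Finset.sum_le_sum e1).trans ?_
    rw [Finset.sum_comm' (t' := S P X) (s' := fun e => (S P X).filter (e ∣ ·))]
    · unfold H
      rw [Finset.mul_sum]
      apply Finset.sum_le_sum
      intro e he
      obtain ⟨he1, he2, he3⟩ := mem_S.1 he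
      have h5 : (0 : ℝ) < e := by exact_mod_cast he1
      have h3 : (0 : ℝ) < Nat.totient e := by exact_mod_cast Nat.totient_pos.2 he1
      rw [← Finset.mul_sum]
      have hinner : ∑ c ∈ (S P X).filter (e ∣ ·), vonMangoldt (c / e) ≤ 6 * (X / e) := by
        have hp := Chebyshev.psi_le_const_mul_self (x := X / e) (by positivity)
        have : ∑ c ∈ (S P X).filter (e ∣ ·), vonMangoldt (c / e) ≤ Chebyshev.psi (X / e) := by
          unfold Chebyshev.psi
          rw [← Finset.sum_image (f := fun d => vonMangoldt d) (g := fun c => c / e)]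
          · apply Finset.sum_le_sum_of_subset_of_nonneg
            · intro d hd
              simp only [mem_image, mem_filter] at hd
              obtain ⟨c, ⟨hc, ⟨k, rfl⟩⟩, rfl⟩ := hd
              obtain ⟨hc1, hc2, hc3⟩ := mem_S.1 hc
              rw [Nat.mul_div_cancel_left _ he1, mem_Ioc]
              have hk : 0 < k := Nat.pos_of_ne_zero (by rintro rfl; simp at hc1)
              refine ⟨hk, (Nat.le_floor_iff' hk.ne').2 ?_⟩
              rw [le_div_iff₀ h5]
              push_cast at hc2; linarith
            · intro i _ _; exact vonMangoldt_nonneg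
          · intro a ha b hb hab
            simp only [coe_filter, Set.mem_ofPred_eq] at ha hb
            have := Nat.div_mul_cancel ha.2
            have h' := Nat.div_mul_cancel hb.2
            simp only at hab
            rw [← this, ← h', hab]
        have h7 : (Real.log 4 + 4) * (X / e) ≤ 6 * (X / e) := by
          have := log4
          gcongr; linarith
        linarith
      calc 2 * ((e : ℝ) / Nat.totient e) * _ ≤ 2 * ((e : ℝ) / Nat.totient e) * (6 * (X / e)) := by
            gcongr
        _ = _ := by field_simp; ring
    · intro x y
      simp only [Nat.mem_divisors, mem_filter]
      constructor
      · rintro ⟨hx, hy, h0⟩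
        refine ⟨⟨hx, hy⟩, ?_⟩
        obtain ⟨a, b, c⟩ := mem_S.1 hx
        refine mem_S.2 ⟨Nat.pos_of_dvd_of_pos hy a, le_trans ?_ b, c.coprime_dvd_left hy⟩
        exact_mod_cast Nat.le_of_dvd a hy
      · rintro ⟨⟨hx, hy⟩, _⟩
        obtain ⟨a, b, c⟩ := mem_S.1 hx
        exact ⟨hx, hy, by omega⟩
  have step2 : ∑ c ∈ S P X, (c : ℝ) / Nat.totient c * (Real.log X - Real.log c) ≤ X * H P X := by
    unfold H
    rw [Finset.mul_sum]
    apply Finset.sum_le_sum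
    intro c hc
    obtain ⟨a, b, _⟩ := mem_S.1 hc
    have h5 : (0 : ℝ) < c := by exact_mod_cast a
    have h3 : (0 : ℝ) < Nat.totient c := by exact_mod_cast Nat.totient_pos.2 a
    rw [← Real.log_div hX.ne' h5.ne']
    have := Real.log_le_sub_one_of_pos (x := X / c) (by positivity)
    calc _ ≤ (c : ℝ) / Nat.totient c * (X / c) := by gcongr; linarith
      _ = _ := by field_simp
  have : G P X * Real.log X = ∑ c ∈ S P X, (c : ℝ) / Nat.totient c * Real.log c +
      ∑ c ∈ S P X, (c : ℝ) / Nat.totient c * (Real.log X - Real.log c) := by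
    unfold G
    rw [← Finset.sum_add_distrib, Finset.sum_mul]
    apply Finset.sum_congr rfl; intros; ring
  rw [this]; linarith

lemma hasSum_tot (p : ℕ) (hp : p.Prime) :
    HasSum (fun n : ℕ => 1 / (Nat.totient (p ^ n) : ℝ)) (1 + 1 / ((p : ℝ) - 1) * w p) := by
  have h2 : (2 : ℝ) ≤ p := by exact_mod_cast hp.two_le
  have h3 : (0 : ℝ) < (p : ℝ) - 1 := by linarith
  have hg := (hasSum_geometric_of_lt_one (r := 1 / (p : ℝ)) (by positivity)
    (by rw [div_lt_one (by linarith)]; linarith)).mul_left (1 / ((p : ℝ) - 1))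
  have : HasSum (fun n : ℕ => 1 / (Nat.totient (p ^ (n + 1)) : ℝ)) (1 / ((p : ℝ) - 1) * w p) := by
    have hfun : (fun n : ℕ => 1 / (Nat.totient (p ^ (n + 1)) : ℝ)) =
        fun i : ℕ => 1 / ((p : ℝ) - 1) * (1 / (p : ℝ)) ^ i := by
      funext n
      rw [Nat.totient_prime_pow_succ hp, Nat.cast_mul, Nat.cast_pow, Nat.cast_sub hp.one_lt.le,
        Nat.cast_one, one_div_pow]
      field_simp
    rw [hfun]
    exact hg
  have h1 := (hasSum_nat_add_iff' (f := fun n : ℕ => 1 / (Nat.totient (p ^ n) : ℝ)) (g := 1 + 1 / ((p : ℝ) - 1) * w p) 1).1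
  apply h1
  simpa using this

lemma H_le (P : ℕ) (X : ℝ) :
    H P X ≤ Real.exp 1 * ∏ p ∈ (pr X).filter (fun p => ¬ p ∣ P), w p := by
  set s := (pr X).filter (fun p => ¬ p ∣ P) with hs
  have hsp : ∀ p ∈ s, p.Prime := fun p hp => (mem_pr.1 (mem_filter.1 hp).1).1
  set f : ℕ → ℝ := fun n => 1 / (Nat.totient n : ℝ) with hf
  have h := (EulerProduct.summable_and_hasSum_factoredNumbers_prod_filter_prime_tsum (f := f)
    (by simp [hf]) (fun {m n} hmn => by simp [hf, Nat.totient_mul hmn, mul_comm])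
    (fun {p} hp => (hasSum_tot p hp).summable.norm) s).2
  rw [Finset.filter_true_of_mem hsp] at h
  have h1 : H P X ≤ ∏ p ∈ s, ∑' n : ℕ, f (p ^ n) := by
    have h' := (hasSum_subtype_iff_indicator (f := f)).1 h
    refine le_trans (le_of_eq ?_) (sum_le_hasSum (S P X) ?_ h')
    · unfold H
      apply Finset.sum_congr rfl
      intro c hc
      obtain ⟨a, b, hcop⟩ := mem_S.1 hc
      rw [Set.indicator_of_mem]
      rw [Nat.mem_factoredNumbers_iff_primeFactors_subset]
      refine ⟨by omega, ?_⟩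
      intro p hp
      have hpp := Nat.prime_of_mem_primeFactors hp
      have hpd := Nat.dvd_of_mem_primeFactors hp
      rw [hs, mem_filter, mem_pr]
      refine ⟨⟨hpp, le_trans ?_ b⟩, ?_⟩
      · exact_mod_cast Nat.le_of_dvd a hpd
      · intro hP
        exact Nat.not_coprime_of_dvd_of_dvd hpp.one_lt hpd hP hcop
    · intro i _
      exact Set.indicator_nonneg (fun x _ => by simp only [hf]; positivity) _
  refine h1.trans ?_
  calc ∏ p ∈ s, ∑' n : ℕ, f (p ^ n) ≤ ∏ p ∈ s, (Real.exp (1 / ((p : ℝ) * (p - 1))) * w p) := by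
        apply Finset.prod_le_prod
        · intro p _; exact tsum_nonneg (fun n => by simp only [hf]; positivity)
        · intro p hp
          have hp := hsp p hp
          simp only [hf]
          rw [(hasSum_tot p hp).tsum_eq]
          have h2 : (2 : ℝ) ≤ p := by exact_mod_cast hp.two_le
          have h3 : (0 : ℝ) < (p : ℝ) - 1 := by linarith
          have h0 : (0 : ℝ) < (p : ℝ) := by linarith
          have e := Real.add_one_le_exp (1 / ((p : ℝ) * (p - 1)))
          have e2 : 1 + 1 / ((p : ℝ) - 1) * w p = (1 / ((p : ℝ) * (p - 1)) + 1) * w p := by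
            unfold w
            field_simp
            ring
          rw [e2]
          exact mul_le_mul_of_nonneg_right e (w_pos hp).le
    _ = Real.exp (∑ p ∈ s, 1 / ((p : ℝ) * (p - 1))) * ∏ p ∈ s, w p := by
        rw [Finset.prod_mul_distrib, Real.exp_sum]
    _ ≤ _ := by
        have := sum_tele s (fun p hp => (hsp p hp).two_le)
        have h0 : 0 ≤ ∏ p ∈ s, w p := Finset.prod_nonneg (fun p hp => (w_pos (hsp p hp)).le)
        gcongr

noncomputable def W' (P : ℕ) : ℝ := ∏ p ∈ P.primeFactors, w p
noncomputable def T (P : ℕ) (X : ℝ) : ℝ := ∏ p ∈ P.primeFactors.filter (fun p : ℕ => X < p), w p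

lemma T_pos (P : ℕ) (X : ℝ) : 0 < T P X :=
  Finset.prod_pos (fun _ hp => w_pos (Nat.prime_of_mem_primeFactors (mem_filter.1 hp).1))

lemma W'_pos (P : ℕ) : 0 < W' P :=
  Finset.prod_pos (fun _ hp => w_pos (Nat.prime_of_mem_primeFactors hp))

lemma T_anti (P : ℕ) {X Y : ℝ} (h : X ≤ Y) : T P Y ≤ T P X := by
  unfold T
  apply Finset.prod_le_prod_of_subset_of_one_le
  · intro p hp
    rw [mem_filter] at hp ⊢
    exact ⟨hp.1, h.trans_lt hp.2⟩
  · intro p hp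
    exact (w_pos (Nat.prime_of_mem_primeFactors (mem_filter.1 hp).1)).le
  · intro p hp _
    exact one_le_w (Nat.prime_of_mem_primeFactors (mem_filter.1 hp).1)

lemma H_bound (P : ℕ) (hP : P ≠ 0) (X : ℝ) (hX : 1 ≤ Real.log X) (hX0 : 0 < X) :
    H P X * W' P ≤ (2 * Real.exp 9) * Real.log X * T P X := by
  have h1 := H_le P X
  have h2 := mertens X hX hX0
  have e1 : W' P = (∏ p ∈ (pr X).filter (fun p => p ∣ P), w p) * T P X := by
    unfold W' T
    rw [← Finset.prod_filter_mul_prod_filter_not P.primeFactors (fun p : ℕ => (p : ℝ) ≤ X)]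
    congr 1
    · apply Finset.prod_congr _ (fun _ _ => rfl)
      ext p
      simp only [mem_filter, mem_pr, Nat.mem_primeFactors]
      tauto
    · simp only [not_le]
  have e2 : (∏ p ∈ (pr X).filter (fun p => p ∣ P), w p) *
    ∏ p ∈ (pr X).filter (fun p => ¬ p ∣ P), w p = ∏ p ∈ pr X, w p :=
    Finset.prod_filter_mul_prod_filter_not _ _ _
  have hA : 0 ≤ ∏ p ∈ (pr X).filter (fun p => p ∣ P), w p :=
    Finset.prod_nonneg (fun p hp => (w_pos (mem_pr.1 (mem_filter.1 hp).1).1).le)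
  have hT := T_pos P X
  have e9 : Real.exp 9 = Real.exp 1 * Real.exp 8 := by rw [← Real.exp_add]; norm_num
  calc H P X * W' P ≤ (Real.exp 1 * ∏ p ∈ (pr X).filter (fun p => ¬ p ∣ P), w p) * W' P := by
        have := W'_pos P
        gcongr
    _ = Real.exp 1 * (∏ p ∈ pr X, w p) * T P X := by rw [e1, ← e2]; ring
    _ ≤ Real.exp 1 * (2 * Real.exp 8 * Real.log X) * T P X := by gcongr
    _ = _ := by rw [e9]; ring

end AOE


namespace AOE

lemma exp_geom (K : ℕ) (R : ℝ) (hR : 0 ≤ R) :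
    ∑ k ∈ (Icc 1 K).filter (fun k : ℕ => Real.exp k ≤ R), Real.exp k ≤ 2 * R := by
  have h1 : ∀ j : ℕ, ∑ k ∈ Icc 1 j, Real.exp k ≤ 2 * Real.exp j := by
    intro j
    induction j with
    | zero => simp
    | succ j ih =>
      rw [Finset.sum_Icc_succ_top (by omega)]
      have : 2 * Real.exp (j : ℝ) ≤ Real.exp ((j + 1 : ℕ) : ℝ) := by
        push_cast
        rw [Real.exp_add]
        have := Real.add_one_le_exp 1
        nlinarith [Real.exp_pos (j : ℝ)]
      linarith
  set F := (Icc 1 K).filter (fun k : ℕ => Real.exp k ≤ R) with hF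
  rcases F.eq_empty_or_nonempty with he | hne
  · rw [he]; simp [hR]
  · have hm := F.max'_mem hne
    have hsub : F ⊆ Icc 1 (F.max' hne) := by
      intro k hk
      rw [mem_Icc]
      refine ⟨?_, F.le_max' k hk⟩
      rw [hF, mem_filter, mem_Icc] at hk
      exact hk.1.1
    calc _ ≤ ∑ k ∈ Icc 1 (F.max' hne), Real.exp k :=
          Finset.sum_le_sum_of_subset_of_nonneg hsub (fun _ _ _ => (Real.exp_pos _).le)
      _ ≤ 2 * Real.exp (F.max' hne : ℕ) := h1 _
      _ ≤ 2 * R := by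
          have := (mem_filter.1 hm).2
          linarith

lemma averaging (P : ℕ) (hP : P ≠ 0) (X : ℝ) (hX : 0 < X) (K : ℕ) (hK : 1 ≤ K) :
    ∑ k ∈ Icc 1 K, G P (X / Real.exp k) / (X / Real.exp k) * W' P ≤
      30 * Real.exp 9 * K * T P (Real.exp K) := by
  set Z := Real.exp K with hZ
  have hK1 : (1 : ℝ) ≤ K := by exact_mod_cast hK
  have hT := T_pos P Z
  have hW := W'_pos P
  rw [← Finset.sum_filter_add_sum_filter_not (Icc 1 K) (fun k : ℕ => Z ≤ X / Real.exp k)]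
  have part1 : ∑ k ∈ (Icc 1 K).filter (fun k : ℕ => Z ≤ X / Real.exp k),
      G P (X / Real.exp k) / (X / Real.exp k) * W' P ≤ 26 * Real.exp 9 * K * T P Z := by
    have hb : ∀ k ∈ (Icc 1 K).filter (fun k : ℕ => Z ≤ X / Real.exp k),
        G P (X / Real.exp k) / (X / Real.exp k) * W' P ≤ 26 * Real.exp 9 * T P Z := by
      intro k hk
      have hZY := (mem_filter.1 hk).2
      set Y := X / Real.exp k with hY
      have hY0 : 0 < Y := by positivity
      have hlog : (K : ℝ) ≤ Real.log Y := by
        rw [Real.le_log_iff_exp_le hY0]; exact hZY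
      have hl0 : 0 < Real.log Y := by linarith
      have h1 := sieve P Y hY0
      have h2 := H_bound P hP Y (by linarith) hY0
      have h3 := T_anti P hZY
      have h4 : G P Y / Y ≤ 13 * H P Y / Real.log Y := by
        rw [div_le_div_iff₀ hY0 hl0]; linarith
      calc _ ≤ 13 * H P Y / Real.log Y * W' P := by gcongr
        _ = 13 * (H P Y * W' P) / Real.log Y := by ring
        _ ≤ 13 * ((2 * Real.exp 9) * Real.log Y * T P Y) / Real.log Y := by gcongr
        _ = 26 * Real.exp 9 * T P Y := by field_simp; ring
        _ ≤ _ := by gcongr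
    refine (Finset.sum_le_card_nsmul _ _ _ hb).trans ?_
    rw [nsmul_eq_mul]
    have hc : (((Icc 1 K).filter (fun k : ℕ => Z ≤ X / Real.exp k)).card : ℝ) ≤ K := by
      have := Finset.card_filter_le (Icc 1 K) (fun k : ℕ => Z ≤ X / Real.exp k)
      rw [Nat.card_Icc] at this
      exact_mod_cast this
    calc _ ≤ (K : ℝ) * (26 * Real.exp 9 * T P Z) := by gcongr
      _ = _ := by ring
  have part2 : ∑ k ∈ (Icc 1 K).filter (fun k : ℕ => ¬ Z ≤ X / Real.exp k),
      G P (X / Real.exp k) / (X / Real.exp k) * W' P ≤ 4 * Real.exp 9 * K * T P Z := by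
    rw [← Finset.sum_mul]
    have h1 : ∑ k ∈ (Icc 1 K).filter (fun k : ℕ => ¬ Z ≤ X / Real.exp k),
        G P (X / Real.exp k) / (X / Real.exp k) ≤ 2 * H P Z := by
      calc _ ≤ ∑ k ∈ Icc 1 K, ∑ c ∈ (S P Z).filter (fun c : ℕ => Real.exp k ≤ X / c),
              (c : ℝ) / Nat.totient c * (Real.exp k / X) := by
            refine le_trans (Finset.sum_le_sum ?_)
              (Finset.sum_le_sum_of_subset_of_nonneg (Finset.filter_subset _ _) ?_)
            · intro k hk
              have hk2 := not_le.1 (mem_filter.1 hk).2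
              unfold G
              rw [Finset.sum_div]
              have : ∀ c ∈ S P (X / Real.exp k), (c : ℝ) / Nat.totient c / (X / Real.exp k) =
                  (c : ℝ) / Nat.totient c * (Real.exp k / X) := by
                intro c _; field_simp
              rw [Finset.sum_congr rfl this]
              apply Finset.sum_le_sum_of_subset_of_nonneg
              · intro c hc
                obtain ⟨a, b, d⟩ := mem_S.1 hc
                rw [mem_filter, mem_S]
                refine ⟨⟨a, b.trans hk2.le, d⟩, ?_⟩
                have h5 : (0 : ℝ) < c := by exact_mod_cast a
                rw [le_div_iff₀ (Real.exp_pos _)] at b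
                rw [le_div_iff₀ h5]; linarith
              · intros; positivity
            · intros; exact Finset.sum_nonneg (fun _ _ => by positivity)
        _ = ∑ c ∈ S P Z, ∑ k ∈ (Icc 1 K).filter (fun k : ℕ => Real.exp k ≤ X / c),
              (c : ℝ) / Nat.totient c * (Real.exp k / X) := by
            apply Finset.sum_comm'
            intro x y; simp only [mem_filter]; tauto
        _ ≤ _ := by
            unfold H
            rw [Finset.mul_sum]
            apply Finset.sum_le_sum
            intro c hc
            obtain ⟨a, b, d⟩ := mem_S.1 hc
            have h5 : (0 : ℝ) < c := by exact_mod_cast a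
            have h3 : (0 : ℝ) < Nat.totient c := by exact_mod_cast Nat.totient_pos.2 a
            rw [← Finset.mul_sum, ← Finset.sum_div]
            have := exp_geom K (X / c) (by positivity)
            calc _ ≤ (c : ℝ) / Nat.totient c * (2 * (X / c) / X) := by gcongr
              _ = _ := by field_simp
    have h2 := H_bound P hP Z (by rw [hZ, Real.log_exp]; exact hK1) (Real.exp_pos _)
    have h3 : Real.log Z = K := by rw [hZ, Real.log_exp]
    rw [h3] at h2
    calc _ ≤ 2 * H P Z * W' P := by gcongr
      _ = 2 * (H P Z * W' P) := by ring
      _ ≤ 2 * ((2 * Real.exp 9) * K * T P Z) := by gcongr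
      _ = _ := by ring
  linarith

lemma T_bound (P : ℕ) (hP : P ≠ 0) (h : ℕ) (hP2 : P ≤ 2 ^ (8 * 4 ^ h)) (K : ℕ) (hK : 1 ≤ K) :
    T P (Real.exp K) ≤ Real.exp ((h * Real.log 4 + 6) / K + 9) := by
  set Z := Real.exp K with hZ
  have hK1 : (1 : ℝ) ≤ K := by exact_mod_cast hK
  set F := P.primeFactors.filter (fun p : ℕ => Z < p) with hF
  have hFp : ∀ p ∈ F, p.Prime := fun p hp => Nat.prime_of_mem_primeFactors (mem_filter.1 hp).1
  refine (prod_w_le F hFp).trans (Real.exp_le_exp.2 ?_)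
  rw [← Finset.sum_filter_add_sum_filter_not F (fun p : ℕ => (p : ℝ) ≤ 4 ^ h)]
  have part1 : ∑ p ∈ F.filter (fun p : ℕ => (p : ℝ) ≤ 4 ^ h), 1 / (p : ℝ) ≤
      (h * Real.log 4 + 6) / K := by
    rw [le_div_iff₀ (by linarith), Finset.sum_mul]
    have h4 : (1 : ℝ) ≤ 4 ^ h := one_le_pow₀ (by norm_num)
    have := sum_logp (4 ^ h) h4
    rw [Real.log_pow] at this
    refine le_trans ?_ this
    refine le_trans (Finset.sum_le_sum (g := fun p : ℕ => Real.log p / p) ?_)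
      (Finset.sum_le_sum_of_subset_of_nonneg ?_ ?_)
    · intro p hp
      obtain ⟨hp1, hp2⟩ := mem_filter.1 hp
      have hpp := hFp p hp1
      have hp0 : (0 : ℝ) < p := by exact_mod_cast hpp.pos
      have : (K : ℝ) ≤ Real.log p := by
        rw [Real.le_log_iff_exp_le hp0]; exact (mem_filter.1 hp1).2.le
      rw [one_div_mul_eq_div]
      gcongr
    · intro p hp
      obtain ⟨hp1, hp2⟩ := mem_filter.1 hp
      exact mem_pr.2 ⟨hFp p hp1, hp2⟩
    · intro p hp _
      have hpp := (mem_pr.1 hp).1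
      have : (1 : ℝ) ≤ p := by exact_mod_cast hpp.one_lt.le
      exact div_nonneg (Real.log_nonneg this) (by linarith)
  have part2 : ∑ p ∈ F.filter (fun p : ℕ => ¬ (p : ℝ) ≤ 4 ^ h), 1 / (p : ℝ) ≤ 8 := by
    have hc : P.primeFactors.card ≤ 8 * 4 ^ h := by
      rw [← Nat.pow_le_pow_iff_right (a := 2) (by norm_num)]
      calc 2 ^ P.primeFactors.card ≤ ∏ p ∈ P.primeFactors, p :=
            Finset.pow_card_le_prod _ _ _
              (fun p hp => (Nat.prime_of_mem_primeFactors hp).two_le)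
        _ ≤ P := Nat.le_of_dvd (Nat.pos_of_ne_zero hP) (Nat.prod_primeFactors_dvd P)
        _ ≤ _ := hP2
    have hb : ∀ p ∈ F.filter (fun p : ℕ => ¬ (p : ℝ) ≤ 4 ^ h), 1 / (p : ℝ) ≤ 1 / 4 ^ h := by
      intro p hp
      have := not_le.1 (mem_filter.1 hp).2
      gcongr
    refine (Finset.sum_le_card_nsmul _ _ _ hb).trans ?_
    rw [nsmul_eq_mul]
    have hc2 : (F.filter (fun p : ℕ => ¬ (p : ℝ) ≤ 4 ^ h)).card ≤ 8 * 4 ^ h :=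
      ((Finset.card_le_card ((Finset.filter_subset _ _).trans (Finset.filter_subset _ _)))).trans hc
    have hc3 : ((F.filter (fun p : ℕ => ¬ (p : ℝ) ≤ 4 ^ h)).card : ℝ) ≤ 8 * 4 ^ h := by
      exact_mod_cast hc2
    calc _ ≤ (8 * 4 ^ h : ℝ) * (1 / 4 ^ h) := by gcongr
      _ = 8 := by field_simp
  linarith

end AOE


namespace AOE

lemma count_bad (d : ℕ) (hd : 0 < d) (B : ℕ → Finset ℕ) (hB : ∀ p ∈ d.primeFactors, B p ⊆ range p) :
    ((((range d).filter (fun t => ∀ p ∈ d.primeFactors, t % p ∉ B p)).card : ℕ) : ℝ) ≤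
      d * ∏ p ∈ d.primeFactors, (1 - ((B p).card : ℝ) / p) := by
  set R := ∏ p ∈ d.primeFactors, p with hR
  have hRd : R ∣ d := Nat.prod_primeFactors_dvd d
  have hR0 : 0 < R := Nat.pos_of_dvd_of_pos hRd hd
  have hcard : ((range d).filter (fun t => ∀ p ∈ d.primeFactors, t % p ∉ B p)).card ≤
      ((d.primeFactors.pi (fun p => range p \ B p)) ×ˢ range (d / R)).card := by
    apply Finset.card_le_card_of_injOn (fun t => (fun p _ => t % p, t / R))
    · intro t ht
      simp only [coe_filter, Set.mem_ofPred_eq, mem_range] at ht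
      simp only [coe_product, Set.mem_prod, mem_coe, Finset.mem_pi, mem_range]
      refine ⟨fun p hp => Finset.mem_sdiff.2 ⟨mem_range.2
        (Nat.mod_lt _ (Nat.prime_of_mem_primeFactors hp).pos), ht.2 p hp⟩, ?_⟩
      exact Nat.div_lt_div_of_lt_of_dvd hRd ht.1
    · intro t _ u _ htu
      simp only [Prod.mk.injEq] at htu
      obtain ⟨h1, h2⟩ := htu
      have h3 : t ≡ u [MOD R] := by
        rw [Nat.modEq_iff_dvd]
        have : ((R : ℕ) : ℤ) = ∏ p ∈ d.primeFactors, (p : ℤ) := by rw [hR]; push_cast; rfl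
        rw [this]
        apply Finset.prod_dvd_of_coprime
        · intro p hp q hq hpq
          have := (Nat.coprime_primes (Nat.prime_of_mem_primeFactors hp)
            (Nat.prime_of_mem_primeFactors hq)).2 hpq
          exact Nat.isCoprime_iff_coprime.2 this
        · intro p hp
          have := congrFun (congrFun h1 p) hp
          exact Nat.modEq_iff_dvd.1 this
      have h3' : t % R = u % R := h3
      rw [← Nat.div_add_mod t R, ← Nat.div_add_mod u R, h2, h3']
  have hc2 : ((((d.primeFactors.pi (fun p => range p \ B p)) ×ˢ range (d / R)).card : ℕ) : ℝ) =
      d * ∏ p ∈ d.primeFactors, (1 - ((B p).card : ℝ) / p) := by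
    rw [Finset.card_product, Finset.card_pi, Finset.card_range]
    push_cast [Nat.cast_div_charZero hRd]
    have : ∀ p ∈ d.primeFactors, (((range p \ B p).card : ℕ) : ℝ) =
        p * (1 - ((B p).card : ℝ) / p) := by
      intro p hp
      have hp0 : (0 : ℝ) < p := by exact_mod_cast (Nat.prime_of_mem_primeFactors hp).pos
      rw [Finset.card_sdiff_of_subset (hB p hp), Nat.cast_sub (Finset.card_le_card (hB p hp)),
        card_range]
      field_simp
    rw [Finset.prod_congr rfl this, Finset.prod_mul_distrib]
    have h5 : (0 : ℝ) < ∏ p ∈ d.primeFactors, (p : ℝ) := by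
      have : ((R : ℕ) : ℝ) = ∏ p ∈ d.primeFactors, (p : ℝ) := by rw [hR]; push_cast; rfl
      rw [← this]; exact_mod_cast hR0
    have h6 : ((R : ℕ) : ℝ) = ∏ p ∈ d.primeFactors, (p : ℝ) := by rw [hR]; push_cast; rfl
    rw [h6]
    field_simp
  rw [← hc2]
  exact_mod_cast hcard

lemma root (p : ℕ) (hp : p.Prime) (u v : ℤ) (hu : ¬ (p : ℤ) ∣ u) :
    ∃ t, t < p ∧ (p : ℤ) ∣ v + t * u := by
  have := Fact.mk hp
  have hu' : (u : ZMod p) ≠ 0 := by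
    rwa [Ne, ZMod.intCast_zmod_eq_zero_iff_dvd]
  refine ⟨(-(v : ZMod p) * (u : ZMod p)⁻¹).val, ZMod.val_lt _, ?_⟩
  rw [← ZMod.intCast_zmod_eq_zero_iff_dvd]
  push_cast
  rw [ZMod.natCast_zmod_val]
  field_simp
  ring

lemma tot_prod (n : ℕ) (hn : 0 < n) :
    (Nat.totient n : ℝ) / n = ∏ p ∈ n.primeFactors, (w p)⁻¹ := by
  have := Nat.totient_eq_mul_prod_factors n
  have h2 : (Nat.totient n : ℝ) = n * ∏ p ∈ n.primeFactors, (1 - (p : ℝ)⁻¹) := by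
    have h3 := congrArg (fun x : ℚ => (x : ℝ)) this
    push_cast at h3
    exact h3
  have hn0 : (0 : ℝ) < n := by exact_mod_cast hn
  rw [h2, mul_div_cancel_left₀ _ hn0.ne']
  apply Finset.prod_congr rfl
  intro p _
  unfold w
  rw [inv_inv, one_div]

lemma local_prod (d m' n' N : ℕ) (hd : 0 < d) (hm' : 0 < m') (hn' : 0 < n') (hN : 0 < N)
    (hcop : Nat.Coprime m' n') :
    ∏ p ∈ d.primeFactors, (if p ∣ m' * n' ∨ p ∣ N then (w p)⁻¹ else (w p)⁻¹ ^ 2) ≤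
    (Nat.totient (d * m') : ℝ) / (d * m' : ℕ) * ((Nat.totient (d * n') : ℝ) / (d * n' : ℕ)) *
      W' (m' * n') * (N / Nat.totient N) := by
  set U := (d * m' * n').primeFactors with hU
  have hU0 : d * m' * n' ≠ 0 := by positivity
  have conv : ∀ (k : ℕ) (f : ℕ → ℝ), k ≠ 0 → k ∣ d * m' * n' →
      ∏ p ∈ k.primeFactors, f p = ∏ p ∈ U, if p ∣ k then f p else 1 := by
    intro k f hk hkd
    rw [← Finset.prod_filter]
    apply Finset.prod_congr _ (fun _ _ => rfl)
    ext p
    simp only [hU, mem_filter, Nat.mem_primeFactors]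
    constructor
    · rintro ⟨a, b, c⟩; exact ⟨⟨a, b.trans hkd, hU0⟩, b⟩
    · rintro ⟨⟨a, b, c⟩, e⟩; exact ⟨a, e, hk⟩
  have hUp : ∀ p ∈ U, p.Prime := fun p hp => Nat.prime_of_mem_primeFactors hp
  have hNw : ∏ p ∈ U, (if p ∣ N then w p else 1) ≤ (N : ℝ) / Nat.totient N := by
    have e : (N : ℝ) / Nat.totient N = ∏ p ∈ N.primeFactors, w p := by
      have := tot_prod N hN
      rw [← inv_div, this, Finset.prod_inv_distrib, inv_inv]
    rw [e, ← Finset.prod_filter]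
    apply Finset.prod_le_prod_of_subset_of_one_le
    · intro p hp
      obtain ⟨h1, h2⟩ := mem_filter.1 hp
      exact Nat.mem_primeFactors.2 ⟨hUp p h1, h2, hN.ne'⟩
    · intro p hp; exact (w_pos (hUp p (mem_filter.1 hp).1)).le
    · intro p hp _; exact one_le_w (Nat.prime_of_mem_primeFactors hp)
  rw [tot_prod _ (by positivity), tot_prod _ (by positivity), W',
    conv d _ hd.ne' ⟨m' * n', by ring⟩, conv (d * m') _ (by positivity) ⟨n', by ring⟩,
    conv (d * n') _ (by positivity) ⟨m', by ring⟩, conv (m' * n') _ (by positivity) ⟨d, by ring⟩]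
  refine le_trans ?_ (mul_le_mul_of_nonneg_left hNw ?_)
  · rw [← Finset.prod_mul_distrib, ← Finset.prod_mul_distrib, ← Finset.prod_mul_distrib]
    apply Finset.prod_le_prod
    · intro p hp
      have := w_pos (hUp p hp)
      split_ifs <;> positivity
    · intro p hp
      have hpp := hUp p hp
      have hw := w_pos hpp
      have hw1 := one_le_w hpp
      have hdv : p ∣ d * m' * n' := Nat.dvd_of_mem_primeFactors hp
      have e1 : (w p)⁻¹ * w p = 1 := inv_mul_cancel₀ hw.ne'
      have e0 : 0 < (w p)⁻¹ := by positivity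
      by_cases h1 : p ∣ d
      · have h2 : p ∣ d * m' := h1.mul_right _
        have h3 : p ∣ d * n' := h1.mul_right _
        simp only [h1, h2, h3, if_true]
        by_cases h4 : p ∣ m' * n'
        · simp only [h4, true_or, if_true]
          rw [mul_assoc ((w p)⁻¹), e1, mul_one]
          split_ifs
          · nlinarith
          · linarith
        · by_cases h5 : p ∣ N
          · simp only [h4, h5, or_true, if_true, if_false, mul_one]
            rw [mul_assoc, e1, mul_one]
          · simp only [h4, h5, or_self, if_false, mul_one]
            rw [sq]
      · have hx : (p ∣ d * m') ↔ p ∣ m' := by rw [hpp.dvd_mul]; tauto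
        have hy : (p ∣ d * n') ↔ p ∣ n' := by rw [hpp.dvd_mul]; tauto
        have hz : (p ∣ m' * n') ↔ p ∣ m' ∨ p ∣ n' := hpp.dvd_mul
        have hor : p ∣ m' ∨ p ∣ n' := by
          rw [mul_assoc, hpp.dvd_mul] at hdv
          rcases hdv with h | h
          · exact absurd h h1
          · exact hz.1 h
        have hnot : ¬ (p ∣ m' ∧ p ∣ n') := fun ⟨a, b⟩ =>
          Nat.not_coprime_of_dvd_of_dvd hpp.one_lt a b hcop
        have hlast : (1 : ℝ) ≤ if p ∣ N then w p else 1 := by split_ifs <;> linarith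
        simp only [hx, hy, hz, h1, hor, if_true, if_false]
        rcases hor with h | h
        · have h' : ¬ p ∣ n' := fun q => hnot ⟨h, q⟩
          simp only [h, h', if_true, if_false, mul_one, e1, one_mul]
          exact hlast
        · have h' : ¬ p ∣ m' := fun q => hnot ⟨q, h⟩
          simp only [h, h', if_true, if_false, mul_one, e1, one_mul]
          exact hlast
  · apply mul_nonneg (mul_nonneg _ _)
    all_goals
      apply Finset.prod_nonneg
      intro p hp
      have := w_pos (hUp p hp)
      split_ifs <;> positivity

def A (d m' n' : ℕ) (c : ℤ) : Finset (ℕ × ℕ) :=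
  ((Icc 1 (d * m')) ×ˢ (Icc 1 (d * n'))).filter (fun x => Nat.Coprime x.1 (d * m') ∧
    Nat.Coprime x.2 (d * n') ∧ ((d * m' * n' : ℕ) : ℤ) ∣ (x.1 * n' - x.2 * m' - c : ℤ))

lemma mem_A {d m' n' : ℕ} {c : ℤ} {a b : ℕ} : (a, b) ∈ A d m' n' c ↔
    (1 ≤ a ∧ a ≤ d * m') ∧ (1 ≤ b ∧ b ≤ d * n') ∧ Nat.Coprime a (d * m') ∧
    Nat.Coprime b (d * n') ∧ ((d * m' * n' : ℕ) : ℤ) ∣ (a * n' - b * m' - c : ℤ) := by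
  unfold A
  simp only [mem_filter, mem_product, mem_Icc]
  tauto

lemma not_dvd_of_cop {p a m : ℕ} (hp : p.Prime) (h : Nat.Coprime a m) (hm : p ∣ m) :
    ¬ (p : ℤ) ∣ (a : ℤ) := by
  rw [Int.natCast_dvd_natCast]
  intro h'
  exact Nat.not_coprime_of_dvd_of_dvd hp.one_lt h' hm h

lemma cop_of_mem {d m' n' : ℕ} {c : ℤ} {a b : ℕ} (hcop : Nat.Coprime m' n')
    (h : (a, b) ∈ A d m' n' c) : Nat.Coprime c.natAbs (m' * n') := by
  obtain ⟨_, _, ha, hb, hdv⟩ := mem_A.1 h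
  apply Nat.Coprime.symm
  rw [Nat.coprime_iff_gcd_eq_one, ← Nat.coprime_iff_gcd_eq_one]
  apply Nat.coprime_of_dvd
  intro p hp hpm hpc
  have hpc' : (p : ℤ) ∣ c := Int.natCast_dvd.2 hpc
  have hpL : (p : ℤ) ∣ ((d * m' * n' : ℕ) : ℤ) := by
    rw [Int.natCast_dvd_natCast, mul_assoc]; exact hpm.mul_left _
  have hpp : Prime (p : ℤ) := Nat.prime_iff_prime_int.1 hp
  have h1 : (p : ℤ) ∣ (a * n' - b * m' : ℤ) := by
    have := dvd_add (hpL.trans hdv) hpc'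
    simpa using this
  rcases (hp.dvd_mul).1 hpm with h | h
  · have h2 : (p : ℤ) ∣ (b * m' : ℤ) := (Int.natCast_dvd_natCast.2 h).mul_left _
    have h3 : (p : ℤ) ∣ (a * n' : ℤ) := by
      have := dvd_add h1 h2; simpa using this
    rcases hpp.dvd_or_dvd h3 with h4 | h4
    · exact not_dvd_of_cop hp ha (h.mul_left _) h4
    · exact Nat.not_coprime_of_dvd_of_dvd hp.one_lt h (Int.natCast_dvd_natCast.1 h4) hcop
  · have h2 : (p : ℤ) ∣ (a * n' : ℤ) := (Int.natCast_dvd_natCast.2 h).mul_left _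
    have h3 : (p : ℤ) ∣ (b * m' : ℤ) := by
      have := dvd_sub h2 h1; simpa using this
    rcases hpp.dvd_or_dvd h3 with h4 | h4
    · exact not_dvd_of_cop hp hb (h.mul_left _) h4
    · exact Nat.not_coprime_of_dvd_of_dvd hp.one_lt (Int.natCast_dvd_natCast.1 h4) h hcop

lemma pair_count {d m' n' : ℕ} {c : ℤ} (hd : 0 < d) (hm' : 0 < m') (hn' : 0 < n') (hc : c ≠ 0)
    (hcop : Nat.Coprime m' n') :
    ((A d m' n' c).card : ℝ) ≤ d * ((Nat.totient (d * m') : ℝ) / (d * m' : ℕ) *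
      ((Nat.totient (d * n') : ℝ) / (d * n' : ℕ)) *
      W' (m' * n') * (c.natAbs / Nat.totient c.natAbs)) := by
  rcases (A d m' n' c).eq_empty_or_nonempty with he | ⟨⟨a0, b0⟩, h0⟩
  · rw [he]
    have := (W'_pos (m' * n')).le
    simp only [card_empty, Nat.cast_zero]
    positivity
  have hcc := cop_of_mem hcop h0
  obtain ⟨_, _, ha0, hb0, hdv0⟩ := mem_A.1 h0
  set B : ℕ → Finset ℕ := fun p => (range p).filter (fun t : ℕ =>
    (p : ℤ) ∣ (a0 + t * m' : ℤ) ∨ (p : ℤ) ∣ (b0 + t * n' : ℤ)) with hB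
  have hm0 : (m' : ℤ) ≠ 0 := by exact_mod_cast hm'.ne'
  have hn0 : (n' : ℤ) ≠ 0 := by exact_mod_cast hn'.ne'
  have hd0 : (d : ℤ) ≠ 0 := by exact_mod_cast hd.ne'
  have hdpos : (0 : ℤ) < d := by exact_mod_cast hd
  -- parametrization
  have param : ∀ a b : ℕ, (a, b) ∈ A d m' n' c → ∃ x y : ℤ, (a : ℤ) = a0 + x * m' ∧
      (b : ℤ) = b0 + y * n' ∧ (d : ℤ) ∣ x - y := by
    intro a b hab
    obtain ⟨_, _, _, _, hdv⟩ := mem_A.1 hab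
    have h1 : ((d * m' * n' : ℕ) : ℤ) ∣ ((a - a0) * n' - (b - b0) * m' : ℤ) := by
      have := dvd_sub hdv hdv0
      have e : ((a - a0) * n' - (b - b0) * m' : ℤ) =
        (a * n' - b * m' - c : ℤ) - (a0 * n' - b0 * m' - c : ℤ) := by ring
      rw [e]; exact this
    have hic : IsCoprime (m' : ℤ) (n' : ℤ) := Nat.isCoprime_iff_coprime.2 hcop
    have h2 : (m' : ℤ) ∣ (a - a0 : ℤ) := by
      apply hic.dvd_of_dvd_mul_right
      have h3 : (m' : ℤ) ∣ ((a - a0) * n' - (b - b0) * m' : ℤ) :=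
        dvd_trans (by push_cast; exact ⟨d * n', by ring⟩) h1
      have := dvd_add h3 (Dvd.intro_left (b - b0 : ℤ) rfl : (m' : ℤ) ∣ (b - b0 : ℤ) * m')
      simpa using this
    have h2' : (n' : ℤ) ∣ (b - b0 : ℤ) := by
      apply hic.symm.dvd_of_dvd_mul_right
      have h3 : (n' : ℤ) ∣ ((a - a0) * n' - (b - b0) * m' : ℤ) :=
        dvd_trans (by push_cast; exact ⟨d * m', by ring⟩) h1
      have := dvd_sub (Dvd.intro_left (a - a0 : ℤ) rfl : (n' : ℤ) ∣ (a - a0 : ℤ) * n') h3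
      simpa using this
    obtain ⟨x, hx⟩ := h2
    obtain ⟨y, hy⟩ := h2'
    refine ⟨x, y, by linarith, by linarith, ?_⟩
    rw [hx, hy] at h1
    have e : (m' * x * n' - n' * y * m' : ℤ) = (x - y) * (m' * n') := by ring
    rw [e] at h1
    push_cast at h1
    rw [mul_assoc] at h1
    exact Int.dvd_of_mul_dvd_mul_right (mul_ne_zero hm0 hn0) h1
  choose! xf yf hxy using param
  have hcardA : (A d m' n' c).card ≤
      ((range d).filter (fun t => ∀ p ∈ d.primeFactors, t % p ∉ B p)).card := by
    apply Finset.card_le_card_of_injOn (fun z => (xf z.1 z.2 % d).toNat)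
    · rintro ⟨a, b⟩ hab
      have hab' : (a, b) ∈ A d m' n' c := hab
      obtain ⟨hx, hy, hxyd⟩ := hxy a b hab'
      obtain ⟨_, _, ha, hb, _⟩ := mem_A.1 hab'
      have hnn : 0 ≤ xf a b % d := Int.emod_nonneg _ hd0
      have hlt : xf a b % d < d := Int.emod_lt_of_pos _ hdpos
      simp only [coe_filter, Set.mem_ofPred_eq, mem_range]
      refine ⟨by omega, ?_⟩
      intro p hp hmem
      have hpp := Nat.prime_of_mem_primeFactors hp
      have hpd := Nat.dvd_of_mem_primeFactors hp
      have hpdz : (p : ℤ) ∣ (d : ℤ) := Int.natCast_dvd_natCast.2 hpd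
      simp only [hB, mem_filter] at hmem
      obtain ⟨_, hmem⟩ := hmem
      set t := (xf a b % d).toNat with ht
      have htz : (t : ℤ) = xf a b % d := Int.toNat_of_nonneg hnn
      have hmod : (p : ℤ) ∣ xf a b - ((t % p : ℕ) : ℤ) := by
        have h1 : (p : ℤ) ∣ xf a b - t := by
          rw [htz]; exact hpdz.trans (Int.dvd_self_sub_emod)
        have h2 : (p : ℤ) ∣ (t : ℤ) - ((t % p : ℕ) : ℤ) := by
          push_cast; exact Int.dvd_self_sub_emod
        have := dvd_add h1 h2
        simpa using this
      rcases hmem with h | h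
      · apply not_dvd_of_cop hpp ha (hpd.mul_right m')
        rw [hx]
        have := dvd_add h (hmod.mul_right (m' : ℤ))
        have e : (a0 + ((t % p : ℕ) : ℤ) * m' + (xf a b - ((t % p : ℕ) : ℤ)) * m' : ℤ) =
          a0 + xf a b * m' := by ring
        rwa [e] at this
      · apply not_dvd_of_cop hpp hb (hpd.mul_right n')
        rw [hy]
        have h3 := dvd_sub hmod (hpdz.trans hxyd)
        have := dvd_add h (h3.mul_right (n' : ℤ))
        have e : (b0 + ((t % p : ℕ) : ℤ) * n' + (xf a b - ((t % p : ℕ) : ℤ) -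
          (xf a b - yf a b)) * n' : ℤ) = b0 + yf a b * n' := by ring
        rwa [e] at this
    · rintro ⟨a, b⟩ hab ⟨a', b'⟩ hab' heq
      have hab : (a, b) ∈ A d m' n' c := hab
      have hab' : (a', b') ∈ A d m' n' c := hab'
      obtain ⟨hx, hy, hxyd⟩ := hxy a b hab
      obtain ⟨hx', hy', hxyd'⟩ := hxy a' b' hab'
      obtain ⟨⟨r1, r2⟩, ⟨r3, r4⟩, _⟩ := mem_A.1 hab
      obtain ⟨⟨s1, s2⟩, ⟨s3, s4⟩, _⟩ := mem_A.1 hab'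
      have hnn : 0 ≤ xf a b % d := Int.emod_nonneg _ hd0
      have hnn' : 0 ≤ xf a' b' % d := Int.emod_nonneg _ hd0
      simp only at heq
      have heq2 : xf a b % d = xf a' b' % d := by omega
      have h1 : (d : ℤ) ∣ xf a b - xf a' b' := Int.ModEq.dvd (show xf a' b' % d = xf a b % d from heq2.symm)
      have h2 : (d : ℤ) ∣ yf a b - yf a' b' := by
        have := dvd_add (dvd_sub h1 hxyd) hxyd'
        have e : xf a b - xf a' b' - (xf a b - yf a b) + (xf a' b' - yf a' b') =
          yf a b - yf a' b' := by ring
        rwa [e] at this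
      have uniq : ∀ (M u v : ℕ), 1 ≤ u → u ≤ M → 1 ≤ v → v ≤ M → (M : ℤ) ∣ (u - v : ℤ) → u = v := by
        intro M u v q1 q2 q3 q4 hM
        have := Int.eq_zero_of_abs_lt_dvd hM (by rw [abs_lt]; omega)
        omega
      have ea : a = a' := by
        apply uniq (d * m') a a' r1 r2 s1 s2
        rw [hx, hx']
        have := mul_dvd_mul_right h1 (m' : ℤ)
        push_cast
        have e : (a0 + xf a b * m' - (a0 + xf a' b' * m') : ℤ) = (xf a b - xf a' b') * m' := by ring
        rwa [e]
      have eb : b = b' := by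
        apply uniq (d * n') b b' r3 r4 s3 s4
        rw [hy, hy']
        have := mul_dvd_mul_right h2 (n' : ℤ)
        push_cast
        have e : (b0 + yf a b * n' - (b0 + yf a' b' * n') : ℤ) = (yf a b - yf a' b') * n' := by ring
        rwa [e]
      rw [ea, eb]
  have hBsub : ∀ p ∈ d.primeFactors, B p ⊆ range p := fun p _ => Finset.filter_subset _ _
  have hcount := count_bad d hd B hBsub
  have hloc := local_prod d m' n' c.natAbs hd hm' hn' (Int.natAbs_pos.2 hc) hcop
  have hterm : ∏ p ∈ d.primeFactors, (1 - ((B p).card : ℝ) / p) ≤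
      ∏ p ∈ d.primeFactors,
        (if p ∣ m' * n' ∨ p ∣ c.natAbs then (w p)⁻¹ else (w p)⁻¹ ^ 2) := by
    apply Finset.prod_le_prod
    · intro p hp
      have hp0 : (0 : ℝ) < p := by exact_mod_cast (Nat.prime_of_mem_primeFactors hp).pos
      have := Finset.card_le_card (hBsub p hp)
      rw [card_range] at this
      have h' : ((B p).card : ℝ) ≤ p := by exact_mod_cast this
      have : ((B p).card : ℝ) / p ≤ 1 := by rw [div_le_one hp0]; exact h'
      linarith
    · intro p hp
      have hpp := Nat.prime_of_mem_primeFactors hp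
      have hpd := Nat.dvd_of_mem_primeFactors hp
      have hp0 : (0 : ℝ) < p := by exact_mod_cast hpp.pos
      have hpP : Prime (p : ℤ) := Nat.prime_iff_prime_int.1 hpp
      have ew : (w p)⁻¹ = 1 - 1 / (p : ℝ) := by unfold w; rw [inv_inv]
      rw [ew]
      have hroot1 : ¬ p ∣ m' → ∃ t ∈ B p, (p : ℤ) ∣ (a0 + t * m' : ℤ) := by
        intro h
        obtain ⟨t, ht, hdvd⟩ := root p hpp m' a0 (by rwa [Int.natCast_dvd_natCast])
        exact ⟨t, mem_filter.2 ⟨mem_range.2 ht, Or.inl hdvd⟩, hdvd⟩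
      have hroot2 : ¬ p ∣ n' → ∃ t ∈ B p, (p : ℤ) ∣ (b0 + t * n' : ℤ) := by
        intro h
        obtain ⟨t, ht, hdvd⟩ := root p hpp n' b0 (by rwa [Int.natCast_dvd_natCast])
        exact ⟨t, mem_filter.2 ⟨mem_range.2 ht, Or.inr hdvd⟩, hdvd⟩
      have hB1 : 1 ≤ (B p).card := by
        rw [Nat.one_le_iff_ne_zero, Finset.card_ne_zero]
        by_cases h : p ∣ m'
        · have h' : ¬ p ∣ n' := fun q => Nat.not_coprime_of_dvd_of_dvd hpp.one_lt h q hcop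
          obtain ⟨t, ht, _⟩ := hroot2 h'
          exact ⟨t, ht⟩
        · obtain ⟨t, ht, _⟩ := hroot1 h
          exact ⟨t, ht⟩
      split_ifs with hcase
      · have : (1 : ℝ) ≤ (B p).card := by exact_mod_cast hB1
        gcongr
      · rw [not_or] at hcase
        have hm1 : ¬ p ∣ m' := fun q => hcase.1 (q.mul_right _)
        have hn1 : ¬ p ∣ n' := fun q => hcase.1 (q.mul_left _)
        obtain ⟨t1, ht1, hd1⟩ := hroot1 hm1
        obtain ⟨t2, ht2, hd2⟩ := hroot2 hn1
        have hne : t1 ≠ t2 := by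
          rintro rfl
          apply hcase.2
          rw [← Int.natCast_dvd]
          have q1 := dvd_sub (hd1.mul_right (n' : ℤ)) (hd2.mul_right (m' : ℤ))
          have q2 : (p : ℤ) ∣ (a0 * n' - b0 * m' - c : ℤ) := by
            refine dvd_trans ?_ hdv0
            rw [Int.natCast_dvd_natCast, mul_assoc]; exact hpd.mul_right _
          have q3 := dvd_sub q1 q2
          have e : ((a0 + t1 * m') * n' - (b0 + t1 * n') * m' - (a0 * n' - b0 * m' - c) : ℤ) = c := by
            ring
          rwa [e] at q3
        have hB2 : 2 ≤ (B p).card := by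
          have : 1 < (B p).card := Finset.one_lt_card.2 ⟨t1, ht1, t2, ht2, hne⟩
          omega
        have hB2' : (2 : ℝ) ≤ (B p).card := by exact_mod_cast hB2
        have : 2 / (p : ℝ) ≤ (B p).card / p := by gcongr
        have e : (1 - 1 / (p : ℝ)) ^ 2 = 1 - 2 / p + (1 / p) ^ 2 := by ring
        rw [e]
        have : 0 ≤ (1 / (p : ℝ)) ^ 2 := by positivity
        linarith
  calc ((A d m' n' c).card : ℝ) ≤ _ := by exact_mod_cast hcardA
    _ ≤ _ := hcount
    _ ≤ _ := by
      apply mul_le_mul_of_nonneg_left (hterm.trans hloc) (by positivity)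

end AOE

namespace AOE

lemma image_Ioo (x δ : ℝ) : (fun y : ℝ => (y : UnitAddCircle)) '' Set.Ioo (x - δ) (x + δ)
    = Metric.ball (x : UnitAddCircle) δ := by
  ext z
  simp only [Set.mem_image, Metric.mem_ball, dist_eq_norm]
  constructor
  · rintro ⟨y, hy, rfl⟩
    rw [← AddCircle.coe_sub, UnitAddCircle.norm_eq]
    have := round_le (y - x) 0
    refine this.trans_lt ?_
    rw [Int.cast_zero, sub_zero, abs_lt]
    constructor <;> linarith [hy.1, hy.2]
  · intro hz
    obtain ⟨y, rfl⟩ := QuotientAddGroup.mk_surjective z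
    change ‖((y : ℝ) : UnitAddCircle) - (x : UnitAddCircle)‖ < δ at hz
    rw [← AddCircle.coe_sub, UnitAddCircle.norm_eq, abs_lt] at hz
    refine ⟨y - round (y - x), ⟨by linarith [hz.1], by linarith [hz.2]⟩, ?_⟩
    have : ((round (y - x) : ℝ) : UnitAddCircle) = 0 := by
      rw [AddCircle.coe_eq_zero_iff]
      exact ⟨round (y - x), by simp⟩
    rw [AddCircle.coe_sub, this, sub_zero]

lemma vol_ball (x : UnitAddCircle) (δ : ℝ) (h : 2 * δ ≤ 1) :
    volume (Metric.ball x δ) = ENNReal.ofReal (2 * δ) := by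
  rw [← measure_congr (AddCircle.closedBall_ae_eq_ball (x := x) (ε := δ)),
    AddCircle.volume_closedBall, min_eq_right h]

lemma E_eq (ψ : ℕ → ℝ) (n : ℕ) : E ψ n =
    ⋃ a ∈ (Finset.Icc 1 n).filter (fun a => Nat.Coprime a n),
      Metric.ball (((a : ℝ) / n : ℝ) : UnitAddCircle) (ψ n / n) := by
  unfold E
  refine Set.iUnion₂_congr fun a _ => ?_
  rw [← image_Ioo, sub_div, add_div]

lemma card_cop (n : ℕ) (hn : 1 ≤ n) :
    ((Finset.Icc 1 n).filter (fun a => Nat.Coprime a n)).card = Nat.totient n := by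
  rw [← Nat.filter_coprime_Ico_eq_totient n 1]
  congr 1
  ext a
  simp only [Finset.mem_filter, Finset.mem_Icc, Finset.mem_Ico, Nat.coprime_comm]
  constructor <;> rintro ⟨⟨h1, h2⟩, h3⟩ <;> exact ⟨⟨h1, by omega⟩, h3⟩

/-- centres meeting: integer shift -/
lemma meet {x y r s : ℝ} (h : (Metric.ball (x : UnitAddCircle) r ∩
    Metric.ball (y : UnitAddCircle) s).Nonempty) : ∃ j : ℤ, |x - y - j| < r + s := by
  obtain ⟨z, hz1, hz2⟩ := h
  rw [Metric.mem_ball] at hz1 hz2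
  have : dist (x : UnitAddCircle) y < r + s :=
    (dist_triangle_left _ _ z).trans_lt (by linarith)
  rw [dist_eq_norm, ← AddCircle.coe_sub, UnitAddCircle.norm_eq] at this
  exact ⟨_, this⟩

lemma vol_E (ψ : ℕ → ℝ) (n : ℕ) (hn : 1 ≤ n) (h0 : 0 < ψ n) (h1 : ψ n ≤ 1 / 2) :
    (volume (E ψ n)).toReal = Nat.totient n * (2 * (ψ n / n)) := by
  have hn' : (0 : ℝ) < n := by exact_mod_cast hn
  have hle : 2 * (ψ n / n) ≤ 1 := by
    rw [mul_div_assoc', div_le_one hn']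
    have : (1 : ℝ) ≤ n := by exact_mod_cast hn
    linarith
  rw [E_eq, measure_biUnion_finset]
  · simp_rw [vol_ball _ _ hle]
    rw [Finset.sum_const, card_cop n hn, nsmul_eq_mul, ENNReal.toReal_mul,
      ENNReal.toReal_ofReal (by positivity)]
    simp
  · intro a ha b hb hab
    rw [Finset.mem_coe, Finset.mem_filter, Finset.mem_Icc] at ha hb
    change Disjoint (Metric.ball _ _) (Metric.ball _ _)
    rw [Set.disjoint_iff_inter_eq_empty, ← Set.not_nonempty_iff_eq_empty]
    intro hne
    obtain ⟨j, hj⟩ := meet hne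
    have h2 : |(a : ℝ) - b - j * n| < 1 := by
      have e : (a : ℝ) - b - j * n = (a / n - b / n - j) * n := by field_simp
      rw [e, abs_mul, abs_of_pos hn']
      calc _ < (ψ n / n + ψ n / n) * n := by gcongr
        _ = 2 * ψ n := by field_simp; ring
        _ ≤ 1 := by linarith
    have h3 : |(a : ℤ) - b - j * n| < 1 := by exact_mod_cast h2
    rw [Int.abs_lt_one_iff] at h3
    have hdv : (n : ℤ) ∣ (a : ℤ) - b := ⟨j, by linarith⟩
    have h4 := Int.eq_zero_of_abs_lt_dvd hdv (by rw [abs_lt]; omega)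
    apply hab; omega
  · intro a _
    exact Metric.isOpen_ball.measurableSet


open Classical in
/-- pairs of reduced residues whose balls meet -/
noncomputable def Prs (ψ : ℕ → ℝ) (m n : ℕ) : Finset (ℕ × ℕ) :=
  (((Finset.Icc 1 m).filter (fun a => Nat.Coprime a m)) ×ˢ
    ((Finset.Icc 1 n).filter (fun a => Nat.Coprime a n))).filter (fun p =>
      (Metric.ball (((p.1 : ℝ) / m : ℝ) : UnitAddCircle) (ψ m / m) ∩
        Metric.ball (((p.2 : ℝ) / n : ℝ) : UnitAddCircle) (ψ n / n)).Nonempty)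

lemma half_div (x : ℝ) (n : ℕ) (hn : 1 ≤ n) (h1 : x ≤ 1 / 2) : 2 * (x / n) ≤ 1 := by
  have hn' : (0 : ℝ) < n := by exact_mod_cast hn
  rw [mul_div_assoc', div_le_one hn']
  have : (1 : ℝ) ≤ n := by exact_mod_cast hn
  linarith

lemma vol_inter (ψ : ℕ → ℝ) (m n : ℕ) (hm : 1 ≤ m) (hn : 1 ≤ n)
    (h0m : 0 < ψ m) (h1m : ψ m ≤ 1 / 2) (h0n : 0 < ψ n) (h1n : ψ n ≤ 1 / 2) :
    (volume (E ψ m ∩ E ψ n)).toReal ≤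
      (Prs ψ m n).card * (2 * min (ψ m / m) (ψ n / n)) := by
  have hsub : E ψ m ∩ E ψ n ⊆ ⋃ p ∈ Prs ψ m n,
      (Metric.ball (((p.1 : ℝ) / m : ℝ) : UnitAddCircle) (ψ m / m) ∩
        Metric.ball (((p.2 : ℝ) / n : ℝ) : UnitAddCircle) (ψ n / n)) := by
    rintro z ⟨h1, h2⟩
    rw [E_eq, Set.mem_iUnion₂] at h1 h2
    obtain ⟨a, ha, ha'⟩ := h1
    obtain ⟨b, hb, hb'⟩ := h2
    rw [Set.mem_iUnion₂]
    refine ⟨(a, b), ?_, ha', hb'⟩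
    unfold Prs
    classical
    exact Finset.mem_filter.2 ⟨Finset.mem_product.2 ⟨ha, hb⟩, z, ha', hb'⟩
  have hle : volume (E ψ m ∩ E ψ n) ≤
      ENNReal.ofReal ((Prs ψ m n).card * (2 * min (ψ m / m) (ψ n / n))) := by
    refine (measure_mono hsub).trans ((measure_biUnion_finset_le _ _).trans ?_)
    have hb : ∀ p ∈ Prs ψ m n, volume (Metric.ball (((p.1 : ℝ) / m : ℝ) : UnitAddCircle) (ψ m / m) ∩
        Metric.ball (((p.2 : ℝ) / n : ℝ) : UnitAddCircle) (ψ n / n)) ≤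
        ENNReal.ofReal (2 * min (ψ m / m) (ψ n / n)) := by
      intro p _
      rcases le_total (ψ m / m) (ψ n / n) with h | h
      · rw [min_eq_left h, ← vol_ball _ _ (half_div _ _ hm h1m)]
        exact measure_mono Set.inter_subset_left
      · rw [min_eq_right h, ← vol_ball _ _ (half_div _ _ hn h1n)]
        exact measure_mono Set.inter_subset_right
    refine (Finset.sum_le_sum hb).trans ?_
    rw [Finset.sum_const, nsmul_eq_mul, ENNReal.ofReal_mul (p := ((Prs ψ m n).card : ℝ)) (by positivity),
      ENNReal.ofReal_natCast]
  have hpos : 0 ≤ min (ψ m / m) (ψ n / n) := le_min (by positivity) (by positivity)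
  exact ENNReal.toReal_le_of_le_ofReal (by positivity) hle

lemma Prs_card (ψ : ℕ → ℝ) (d m' n' : ℕ) (hd : 0 < d) (hm' : 0 < m') (hn' : 0 < n')
    (hne : m' ≠ n') (hcop : Nat.Coprime m' n') (X : ℝ)
    (hX : (ψ (d * m') / (d * m' : ℕ) + ψ (d * n') / (d * n' : ℕ)) * (d * m' * n') ≤ X) :
    ((Prs ψ (d * m') (d * n')).card : ℝ) ≤
      2 * (d * ((Nat.totient (d*m') : ℝ)/(d*m' : ℕ) * ((Nat.totient (d*n') : ℝ)/(d*n' : ℕ))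
        * W' (m'*n'))) * G (m' * n') X := by
  have hdR : (0 : ℝ) < d := by exact_mod_cast hd
  have hmR : (0 : ℝ) < m' := by exact_mod_cast hm'
  have hnR : (0 : ℝ) < n' := by exact_mod_cast hn'
  have hsub : Prs ψ (d * m') (d * n') ⊆ (S (m' * n') X).biUnion
      (fun c => A d m' n' (c : ℤ) ∪ A d m' n' (-(c : ℤ))) := by
    rintro ⟨a, b⟩ hab
    unfold Prs at hab
    classical
    replace hab := Finset.mem_filter.1 hab
    rw [Finset.mem_product, Finset.mem_filter, Finset.mem_filter,
      Finset.mem_Icc, Finset.mem_Icc] at hab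
    obtain ⟨⟨⟨ha1, ha2⟩, hb1, hb2⟩, hint⟩ := hab
    obtain ⟨j, hj⟩ := meet hint
    simp only at ha1 ha2 hb1 hb2 hj
    set c : ℤ := a * n' - b * m' - j * (d * m' * n') with hc
    have hmem : (a, b) ∈ A d m' n' c := by
      rw [mem_A]
      refine ⟨ha1, hb1, ha2, hb2, j, ?_⟩
      rw [hc]; push_cast; ring
    have hcc := cop_of_mem hcop hmem
    have hcX : (c.natAbs : ℝ) ≤ X := by
      rw [Nat.cast_natAbs, Int.cast_abs]
      have e : (c : ℝ) = ((a : ℝ) / (d * m' : ℕ) - b / (d * n' : ℕ) - j) * (d * m' * n') := by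
        rw [hc]; push_cast; field_simp
      rw [e, abs_mul, abs_of_pos (a := (d : ℝ) * m' * n') (by positivity)]
      refine le_trans ?_ hX
      gcongr
    have hc0 : 1 ≤ c.natAbs := by
      rw [Nat.one_le_iff_ne_zero]
      intro h0
      rw [h0, Nat.coprime_zero_left] at hcc
      have := mul_eq_one.1 hcc
      omega
    rw [Finset.mem_biUnion]
    refine ⟨c.natAbs, mem_S.2 ⟨hc0, hcX, hcc⟩, ?_⟩
    rw [Finset.mem_union]
    rcases Int.natAbs_eq c with h | h
    · left; rw [← h]; exact hmem
    · right; rw [← h]; exact hmem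
  have h1 := (Finset.card_le_card hsub).trans Finset.card_biUnion_le
  have h2 : ((Prs ψ (d * m') (d * n')).card : ℝ) ≤ ∑ c ∈ S (m' * n') X,
      ((A d m' n' (c : ℤ) ∪ A d m' n' (-(c : ℤ))).card : ℝ) := by exact_mod_cast h1
  refine h2.trans ?_
  unfold G
  rw [Finset.mul_sum]
  refine Finset.sum_le_sum fun c hc => ?_
  have hc1 := (mem_S.1 hc).1
  have hz : (c : ℤ) ≠ 0 := by omega
  have hz' : -(c : ℤ) ≠ 0 := by omega
  have q1 := pair_count hd hm' hn' hz hcop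
  have q2 := pair_count hd hm' hn' hz' hcop
  rw [Int.natAbs_neg] at q2
  rw [Int.natAbs_natCast] at q1 q2
  have q3 : ((A d m' n' (c : ℤ) ∪ A d m' n' (-(c : ℤ))).card : ℝ) ≤
      (A d m' n' (c : ℤ)).card + (A d m' n' (-(c : ℤ))).card := by
    exact_mod_cast Finset.card_union_le _ _
  refine (q3.trans (add_le_add q1 q2)).trans (le_of_eq ?_)
  ring

lemma overlap (ψ : ℕ → ℝ) (d m' n' : ℕ) (hd : 0 < d) (hm' : 0 < m') (hn' : 0 < n')
    (hne : m' ≠ n') (hcop : Nat.Coprime m' n')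
    (h0m : 0 < ψ (d * m')) (h1m : ψ (d * m') ≤ 1 / 2)
    (h0n : 0 < ψ (d * n')) (h1n : ψ (d * n') ≤ 1 / 2) (X : ℝ)
    (hX : X = 2 * max (ψ (d * m') * n') (ψ (d * n') * m')) :
    (volume (E ψ (d * m') ∩ E ψ (d * n'))).toReal /
      ((volume (E ψ (d * m'))).toReal * (volume (E ψ (d * n'))).toReal) ≤
      2 * (G (m' * n') X / X * W' (m' * n')) := by
  have hm : 1 ≤ d * m' := Nat.mul_pos hd hm'
  have hn : 1 ≤ d * n' := Nat.mul_pos hd hn'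
  have hdR : (0 : ℝ) < d := by exact_mod_cast hd
  have hmR : (0 : ℝ) < m' := by exact_mod_cast hm'
  have hnR : (0 : ℝ) < n' := by exact_mod_cast hn'
  rw [vol_E ψ _ hm h0m h1m, vol_E ψ _ hn h0n h1n]
  have hv := vol_inter ψ _ _ hm hn h0m h1m h0n h1n
  have hc := Prs_card ψ d m' n' hd hm' hn' hne hcop X (by
    have e : (ψ (d * m') / (d * m' : ℕ) + ψ (d * n') / (d * n' : ℕ)) * (d * m' * n') =
      ψ (d * m') * n' + ψ (d * n') * m' := by push_cast; field_simp
    rw [e, hX]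
    linarith [le_max_left (ψ (d * m') * n') (ψ (d * n') * m'),
      le_max_right (ψ (d * m') * n') (ψ (d * n') * m')])
  have hp1 : (0 : ℝ) < Nat.totient (d * m') := by exact_mod_cast Nat.totient_pos.2 hm
  have hp2 : (0 : ℝ) < Nat.totient (d * n') := by exact_mod_cast Nat.totient_pos.2 hn
  generalize (Nat.totient (d * m') : ℝ) = f1 at *
  generalize (Nat.totient (d * n') : ℝ) = f2 at *
  have hminpos : 0 < min (ψ (d * m') / (d * m' : ℕ)) (ψ (d * n') / (d * n' : ℕ)) :=
    lt_min (by positivity) (by positivity)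
  have hX0 : 0 < X := by rw [hX]; positivity
  rw [div_le_iff₀ (by positivity)]
  refine (hv.trans (mul_le_mul_of_nonneg_right hc (by positivity))).trans (le_of_eq ?_)
  have hXm : 2 * (min (ψ (d * m') / (d * m' : ℕ)) (ψ (d * n') / (d * n' : ℕ))) * X =
      4 * (ψ (d * m') / (d * m' : ℕ)) * (ψ (d * n') / (d * n' : ℕ)) * (d * m' * n') := by
    rw [hX]
    rcases le_total (ψ (d * m') * n') (ψ (d * n') * m') with h | h
    · rw [max_eq_right h, min_eq_left]
      · push_cast; field_simp; ring
      · push_cast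
        rw [div_le_div_iff₀ (by positivity) (by positivity)]
        nlinarith
    · rw [max_eq_left h, min_eq_right]
      · push_cast; field_simp; ring
      · push_cast
        rw [div_le_div_iff₀ (by positivity) (by positivity)]
        nlinarith
  generalize min (ψ (d * m') / (d * m' : ℕ)) (ψ (d * n') / (d * n' : ℕ)) = μ at *
  have e2 : 2 * μ = 4 * (ψ (d * m') / (d * m' : ℕ)) * (ψ (d * n') / (d * n' : ℕ)) * (d * m' * n') / X := by
    rw [eq_div_iff hX0.ne']; exact hXm
  rw [e2]
  push_cast
  field_simp
  try ring

end AOE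
/-- Averaged overlap estimate: the sum over `k = 1, …, K` of the normalized overlaps of the
downscaled sets is `≪ K`. -/
theorem averaged_overlap_estimate (ε : ℝ) (hε : 0 < ε) :
    ∃ C : ℝ, 0 < C ∧ ∀ (h : ℕ), 1 ≤ h → ∀ (m n : ℕ),
      2 ^ 4 ^ h ≤ m → m < n → n < 2 ^ 4 ^ (h + 1) →
      ∀ (ψ : ℕ → ℝ), (∀ j, 0 ≤ ψ j) →
      1 / (m : ℝ) ≤ ψ m → ψ m ≤ 1 / 2 → 1 / (n : ℝ) ≤ ψ n → ψ n ≤ 1 / 2 →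
      ∑ k ∈ Finset.Icc 1 ⌊ε * h * Real.log 4⌋₊,
          (volume (E (Function.update (Function.update ψ m (ψ m / Real.exp k)) n
                (ψ n / Real.exp k)) m ∩
              E (Function.update (Function.update ψ m (ψ m / Real.exp k)) n
                (ψ n / Real.exp k)) n)).toReal /
            ((volume (E (Function.update (Function.update ψ m (ψ m / Real.exp k)) n
                (ψ n / Real.exp k)) m)).toReal *
              (volume (E (Function.update (Function.update ψ m (ψ m / Real.exp k)) n
                (ψ n / Real.exp k)) n)).toReal) ≤
        C * ⌊ε * h * Real.log 4⌋₊ := by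
  refine ⟨60 * Real.exp 9 * Real.exp (2 / ε + 15), by positivity, ?_⟩
  intro h hh m n hm hmn hn ψ _ hm1 hm2 hn1 hn2
  rcases Nat.eq_zero_or_pos ⌊ε * h * Real.log 4⌋₊ with hK0 | hK
  · rw [hK0]; simp
  generalize hKd : ⌊ε * h * Real.log 4⌋₊ = K at hK ⊢
  have hmpos : 0 < m := lt_of_lt_of_le (by positivity) hm
  have hnpos : 0 < n := hmpos.trans hmn
  have hψm : 0 < ψ m := lt_of_lt_of_le (by positivity) hm1
  have hψn : 0 < ψ n := lt_of_lt_of_le (by positivity) hn1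
  obtain ⟨d, m', n', hd, hcop, em, en⟩ := Nat.exists_coprime' (m := m) (n := n)
    (Nat.gcd_pos_of_pos_left _ hmpos)
  rw [mul_comm] at em en
  have hm' : 0 < m' := Nat.pos_of_ne_zero (by rintro rfl; simp at em; omega)
  have hn' : 0 < n' := Nat.pos_of_ne_zero (by rintro rfl; simp at en; omega)
  have hne : m' ≠ n' := by rintro rfl; omega
  have hmR : (0 : ℝ) < m' := by exact_mod_cast hm'
  have hnR : (0 : ℝ) < n' := by exact_mod_cast hn'
  have hX0 : 0 < 2 * max (ψ m * n') (ψ n * m') := by positivity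
  have key : ∀ k : ℕ, (volume (E (Function.update (Function.update ψ m (ψ m / Real.exp k)) n
                (ψ n / Real.exp k)) m ∩
              E (Function.update (Function.update ψ m (ψ m / Real.exp k)) n
                (ψ n / Real.exp k)) n)).toReal /
            ((volume (E (Function.update (Function.update ψ m (ψ m / Real.exp k)) n
                (ψ n / Real.exp k)) m)).toReal *
              (volume (E (Function.update (Function.update ψ m (ψ m / Real.exp k)) n
                (ψ n / Real.exp k)) n)).toReal) ≤
      2 * (AOE.G (m' * n') ((2 * max (ψ m * n') (ψ n * m')) / Real.exp k) /
        ((2 * max (ψ m * n') (ψ n * m')) / Real.exp k) * AOE.W' (m' * n')) := by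
    intro k
    have u1 : Function.update (Function.update ψ m (ψ m / Real.exp k)) n
                (ψ n / Real.exp k) m = ψ m / Real.exp k := by
      rw [Function.update_of_ne hmn.ne, Function.update_self]
    have u2 : Function.update (Function.update ψ m (ψ m / Real.exp k)) n
                (ψ n / Real.exp k) n = ψ n / Real.exp k := by
      rw [Function.update_self]
    generalize Function.update (Function.update ψ m (ψ m / Real.exp k)) n
                (ψ n / Real.exp k) = φ at u1 u2 ⊢
    have hexp : 1 ≤ Real.exp k := Real.one_le_exp (by positivity)
    have v1 : 0 < φ m := by rw [u1]; positivity
    have v2 : 0 < φ n := by rw [u2]; positivity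
    have v3 : φ m ≤ 1 / 2 := by rw [u1]; exact (div_le_self hψm.le hexp).trans hm2
    have v4 : φ n ≤ 1 / 2 := by rw [u2]; exact (div_le_self hψn.le hexp).trans hn2
    have hX : 2 * max (ψ m * n') (ψ n * m') / Real.exp k = 2 * max (φ m * n') (φ n * m') := by
      rw [u1, u2, div_mul_eq_mul_div, div_mul_eq_mul_div, max_div_div_right (by positivity),
        mul_div_assoc]
    have := AOE.overlap φ d m' n' hd hm' hn' hne hcop (by rwa [← em]) (by rwa [← em])
      (by rwa [← en]) (by rwa [← en])
      (2 * max (ψ m * n') (ψ n * m') / Real.exp k) (by rw [← em, ← en]; exact hX)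
    rw [← em, ← en] at this
    exact this
  have hP : m' * n' ≠ 0 := (Nat.mul_pos hm' hn').ne'
  have hP2 : m' * n' ≤ 2 ^ (8 * 4 ^ h) := by
    have e : 8 * 4 ^ h = 4 ^ (h + 1) + 4 ^ (h + 1) := by ring
    rw [e, pow_add]
    have h1 : m' ≤ m := by rw [em]; exact Nat.le_mul_of_pos_left _ hd
    have h2 : n' ≤ n := by rw [en]; exact Nat.le_mul_of_pos_left _ hd
    exact Nat.mul_le_mul (by omega) (by omega)
  have hT := AOE.T_bound (m' * n') hP h hP2 K hK
  have hA := AOE.averaging (m' * n') hP _ hX0 K hK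
  have hKR : (1 : ℝ) ≤ K := by exact_mod_cast hK
  have hexpo : (h * Real.log 4 + 6) / K + 9 ≤ 2 / ε + 15 := by
    have hfl : ε * h * Real.log 4 < K + 1 := by rw [← hKd]; exact Nat.lt_floor_add_one _
    have h1 : h * Real.log 4 ≤ 2 / ε * K := by
      rw [div_mul_eq_mul_div, le_div_iff₀ hε]; linarith
    have h2 : (h * Real.log 4 + 6) / K ≤ 2 / ε + 6 := by
      rw [div_le_iff₀ (by positivity)]; linarith
    linarith
  calc _ ≤ ∑ k ∈ Finset.Icc 1 K, 2 * (AOE.G (m' * n') ((2 * max (ψ m * n') (ψ n * m')) / Real.exp k) /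
        ((2 * max (ψ m * n') (ψ n * m')) / Real.exp k) * AOE.W' (m' * n')) :=
        Finset.sum_le_sum fun k _ => key k
    _ ≤ 2 * (30 * Real.exp 9 * K * AOE.T (m' * n') (Real.exp K)) := by
        rw [← Finset.mul_sum]; linarith
    _ ≤ 2 * (30 * Real.exp 9 * K * Real.exp (2 / ε + 15)) := by
        gcongr
        exact hT.trans (Real.exp_le_exp.2 hexpo)
    _ = _ := by ring
end

section
/- For every ε > 0 there is a constant C = C(ε) > 0 with the following property. Let h ≥ 1 be an integer, set K = ⌊ε·h·log 4⌋, and let m, n be integers with 2^{4^h} ≤ m < n < 2^{4^{h+1}}, and let ψ: ℕ → ℝ satisfy 1/m ≤ ψ(m) ≤ 1/2 and 1/n ≤ ψ(n) ≤ 1/2. For k ≥ 1 let ψ_k be the function obtained from ψ by replacing ψ(m) with ψ(m)/e^k and ψ(n) with ψ(n)/e^k. Then ∑_{k=1}^K e^{2k}·λ(E_m(ψ_k) ∩ E_n(ψ_k)) ≤ C·K·λ(E_m(ψ))·λ(E_n(ψ)). -/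
open MeasureTheory Filter Finset

lemma aux_swap (N : ℕ) (F : ℕ → ℕ → ℝ) :
    ∑ c ∈ Ioc 0 N, ∑ x ∈ c.divisorsAntidiagonal, F x.1 x.2
      = ∑ e ∈ Ioc 0 N, ∑ d ∈ Ioc 0 (N / e), F d e := by
  rw [Finset.sum_sigma', Finset.sum_sigma']
  refine Finset.sum_bij' (fun x _ => ⟨x.2.2, x.2.1⟩) (fun y _ => ⟨y.2 * y.1, (y.2, y.1)⟩) ?_ ?_ ?_ ?_ ?_
  · rintro ⟨c, d, e⟩ h
    simp only [mem_sigma, mem_Ioc, Nat.mem_divisorsAntidiagonal] at h ⊢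
    obtain ⟨⟨h1, h2⟩, rfl, h3⟩ := h
    have hd : 0 < d := Nat.pos_of_ne_zero (by rintro rfl; simp at h3)
    have he : 0 < e := Nat.pos_of_ne_zero (by rintro rfl; simp at h3)
    refine ⟨⟨he, ?_⟩, hd, ?_⟩
    · exact le_trans (Nat.le_mul_of_pos_left _ hd) h2
    · exact (Nat.le_div_iff_mul_le he).2 h2
  · rintro ⟨e, d⟩ h
    simp only [mem_sigma, mem_Ioc, Nat.mem_divisorsAntidiagonal] at h ⊢
    obtain ⟨⟨h1, h2⟩, h3, h4⟩ := h
    refine ⟨⟨Nat.mul_pos h3 h1, (Nat.le_div_iff_mul_le h1).1 h4⟩, ?_⟩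
    exact ⟨trivial, (Nat.mul_pos h3 h1).ne'⟩
  · rintro ⟨c, d, e⟩ h
    simp only [mem_sigma, mem_Ioc, Nat.mem_divisorsAntidiagonal] at h
    obtain ⟨⟨h1, h2⟩, rfl, h3⟩ := h
    rfl
  · rintro ⟨e, d⟩ h
    rfl
  · rintro ⟨c, d, e⟩ h
    rfl

lemma aux_swap_log (N : ℕ) (f : ℕ → ℝ) :
    ∑ c ∈ Ioc 0 N, f c * Real.log c
      = ∑ e ∈ Ioc 0 N, ∑ d ∈ Ioc 0 (N / e), ArithmeticFunction.vonMangoldt d * f (d * e) := by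
  rw [← aux_swap N (fun d e => ArithmeticFunction.vonMangoldt d * f (d * e))]
  refine Finset.sum_congr rfl fun c hc => ?_
  have : ∑ x ∈ c.divisorsAntidiagonal, ArithmeticFunction.vonMangoldt x.1 * f (x.1 * x.2)
      = ∑ x ∈ c.divisorsAntidiagonal, ArithmeticFunction.vonMangoldt x.1 * f c := by
    refine Finset.sum_congr rfl fun x hx => ?_
    rw [(Nat.mem_divisorsAntidiagonal.1 hx).1]
  rw [this, ← Finset.sum_mul, Nat.sum_divisorsAntidiagonal (fun i _ => ArithmeticFunction.vonMangoldt i),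
    ArithmeticFunction.vonMangoldt_sum, mul_comm]

/-- the Chebyshev constant -/
lemma aux_cheb : ∃ C : ℝ, 0 < C ∧ ∀ N e : ℕ, 0 < e →
    ∑ d ∈ Ioc 0 (N / e), ArithmeticFunction.vonMangoldt d ≤ C * (N / e : ℝ) := by
  refine ⟨Real.log 4 + 4, by positivity, fun N e he => ?_⟩
  have h := Chebyshev.psi_le_const_mul_self (x := (N / e : ℝ)) (by positivity)
  rw [Chebyshev.psi] at h
  rwa [Nat.floor_div_natCast, Nat.floor_natCast] at h

/-- Mertens' first theorem, upper bound -/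
lemma aux_mertens1 : ∃ C : ℝ, 0 < C ∧ ∀ N : ℕ, 0 < N →
    ∑ p ∈ N.primesLE, Real.log p / p ≤ Real.log N + C := by
  obtain ⟨C, hC, hCh⟩ := aux_cheb
  refine ⟨C, hC, fun N hN => ?_⟩
  have hN' : (0 : ℝ) < N := by exact_mod_cast hN
  have h1 : ∑ d ∈ Ioc 0 N, ArithmeticFunction.vonMangoldt d * ((N / d : ℕ) : ℝ)
      = ∑ c ∈ Ioc 0 N, Real.log c := by
    have := aux_swap_log N (fun _ => 1)
    simp only [one_mul, mul_one] at this
    rw [this]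
    have h2 := aux_swap N (fun d e => ArithmeticFunction.vonMangoldt d)
    have h3 := aux_swap N (fun d e => ArithmeticFunction.vonMangoldt e)
    rw [← h2]
    simp only [Finset.sum_const, Nat.card_Ioc, nsmul_eq_mul, Nat.sub_zero] at h3
    simp_rw [mul_comm (ArithmeticFunction.vonMangoldt _)]
    rw [← h3]
    refine Finset.sum_congr rfl fun c hc => ?_
    rw [Nat.sum_divisorsAntidiagonal (fun i _ => ArithmeticFunction.vonMangoldt i),
      Nat.sum_divisorsAntidiagonal' (fun _ i => ArithmeticFunction.vonMangoldt i)]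
  have h2 : ∑ c ∈ Ioc 0 N, Real.log c ≤ N * Real.log N := by
    calc ∑ c ∈ Ioc 0 N, Real.log c ≤ ∑ c ∈ Ioc 0 N, Real.log N := by
          refine Finset.sum_le_sum fun c hc => ?_
          rw [mem_Ioc] at hc
          exact Real.log_le_log (by exact_mod_cast hc.1) (by exact_mod_cast hc.2)
      _ = _ := by simp
  have h3 : ∑ d ∈ Ioc 0 N, ArithmeticFunction.vonMangoldt d * ((N / d : ℝ) - 1)
      ≤ N * Real.log N := by
    rw [← h1] at h2
    refine le_trans (Finset.sum_le_sum fun d hd => ?_) h2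
    refine mul_le_mul_of_nonneg_left ?_ ArithmeticFunction.vonMangoldt_nonneg
    have := Nat.lt_floor_add_one (N / d : ℝ)
    rw [Nat.floor_div_natCast, Nat.floor_natCast] at this
    linarith
  have h4 := hCh N 1 one_pos
  simp only [Nat.div_one, Nat.cast_one, div_one] at h4
  have h5 : N * ∑ d ∈ Ioc 0 N, ArithmeticFunction.vonMangoldt d / d ≤ N * (Real.log N + C) := by
    have : N * ∑ d ∈ Ioc 0 N, ArithmeticFunction.vonMangoldt d / d =
      ∑ d ∈ Ioc 0 N, ArithmeticFunction.vonMangoldt d * ((N / d : ℝ) - 1)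
        + ∑ d ∈ Ioc 0 N, ArithmeticFunction.vonMangoldt d := by
      rw [← Finset.sum_add_distrib, Finset.mul_sum]
      refine Finset.sum_congr rfl fun d hd => ?_
      ring
    rw [this]; linarith
  have h6 := le_of_mul_le_mul_left h5 hN'
  refine le_trans ?_ h6
  calc ∑ p ∈ N.primesLE, Real.log p / p
      = ∑ p ∈ N.primesLE, ArithmeticFunction.vonMangoldt p / p := by
        refine Finset.sum_congr rfl fun p hp => ?_
        rw [ArithmeticFunction.vonMangoldt_apply_prime (Nat.prime_of_mem_primesLE hp)]
    _ ≤ _ := by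
        refine Finset.sum_le_sum_of_subset_of_nonneg ?_ ?_
        · intro p hp
          rw [mem_Ioc]
          exact ⟨(Nat.prime_of_mem_primesLE hp).pos, Nat.le_of_mem_primesLE hp⟩
        · intro d _ _
          exact div_nonneg ArithmeticFunction.vonMangoldt_nonneg (by positivity)

lemma aux_primesLE_succ (N : ℕ) (f : ℕ → ℝ) :
    ∑ p ∈ (N+1).primesLE, f p = ∑ p ∈ N.primesLE, f p + if (N+1).Prime then f (N+1) else 0 := by
  rw [Nat.primesLE_eq_filter_range, Nat.primesLE_eq_filter_range, Finset.sum_filter,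
    Finset.sum_filter, Finset.sum_range_succ]

/-- Mertens' second theorem, upper bound -/
lemma aux_mertens2 : ∃ C : ℝ, 0 < C ∧ ∀ N : ℕ, 2 ≤ N →
    ∑ p ∈ N.primesLE, 1 / (p : ℝ) ≤ Real.log (Real.log N) + C := by
  obtain ⟨C, hC, hM⟩ := aux_mertens1
  have key : ∃ D : ℝ, 0 < D ∧ ∀ N : ℕ, 2 ≤ N →
      ∑ p ∈ N.primesLE, 1 / (p : ℝ) - (∑ p ∈ N.primesLE, Real.log p / p) / Real.log N
        ≤ Real.log (Real.log N) - C / Real.log N + D := by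
    let L := ∑ p ∈ (2 : ℕ).primesLE, 1 / (p : ℝ) -
      (∑ p ∈ (2 : ℕ).primesLE, Real.log p / p) / Real.log (2 : ℕ) -
      (Real.log (Real.log (2 : ℕ)) - C / Real.log (2 : ℕ))
    refine ⟨|L| + 1, by positivity, fun N hN => ?_⟩
    induction N, hN using Nat.le_induction with
    | base => have := le_abs_self L; simp only [L] at this ⊢; linarith
    | succ N hN ih =>
      have hN1 : (1 : ℝ) < N := by exact_mod_cast hN
      have l1 : 0 < Real.log N := Real.log_pos hN1
      have l2 : Real.log N < Real.log (N + 1 : ℕ) :=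
        Real.log_lt_log (by linarith) (by push_cast; linarith)
      have hMN := hM N (by omega)
      set M := ∑ p ∈ N.primesLE, Real.log p / p with hMdef
      have e1 : ∑ p ∈ (N+1).primesLE, 1 / (p : ℝ) -
          (∑ p ∈ (N+1).primesLE, Real.log p / p) / Real.log (N + 1 : ℕ)
          = ∑ p ∈ N.primesLE, 1 / (p : ℝ) - M / Real.log (N + 1 : ℕ) := by
        rw [aux_primesLE_succ, aux_primesLE_succ]
        rw [← hMdef]
        have : Real.log (N + 1 : ℕ) ≠ 0 := by linarith
        split_ifs
        · field_simp
          ring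
        · simp
      rw [e1]
      set a := Real.log N
      set b := Real.log (N + 1 : ℕ)
      have hb : 0 < b := by linarith
      have h3 : M * (1 / a - 1 / b) ≤ (a + C) * (1 / a - 1 / b) := by
        apply mul_le_mul_of_nonneg_right hMN
        rw [sub_nonneg]
        exact one_div_le_one_div_of_le l1 l2.le
      have h4 : 1 - a / b ≤ Real.log b - Real.log a := by
        have := Real.log_le_sub_one_of_pos (div_pos l1 hb)
        rw [Real.log_div l1.ne' hb.ne'] at this
        linarith
      have h5 : (a + C) * (1 / a - 1 / b) = 1 - a / b + C / a - C / b := by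
        field_simp; ring
      have h6 : M * (1 / a - 1 / b) = M / a - M / b := by ring
      linarith
  obtain ⟨D, hD, hkey⟩ := key
  refine ⟨D + 1, by linarith, fun N hN => ?_⟩
  have h := hkey N hN
  have h1 := hM N (by omega)
  have l1 : 0 < Real.log N := Real.log_pos (by exact_mod_cast hN)
  have h2 : (∑ p ∈ N.primesLE, Real.log p / p) / Real.log N ≤ 1 + C / Real.log N := by
    rw [div_le_iff₀ l1, add_mul, div_mul_cancel₀ _ l1.ne']
    linarith
  linarith

lemma aux_sum_inv (N : ℕ) : ∑ p ∈ N.primesLE, 1 / ((p : ℝ) * (p - 1)) ≤ 1 := by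
  have h : ∀ N : ℕ, 1 ≤ N → ∑ p ∈ Ioc 1 N, 1 / ((p : ℝ) * (p - 1)) ≤ 1 - 1 / N := by
    intro N hN
    induction N, hN using Nat.le_induction with
    | base => simp
    | succ N hN ih =>
      have hN' : (0 : ℝ) < N := by exact_mod_cast hN
      rw [← Finset.insert_Ioc_right_eq_Ioc_add_one (by omega), Finset.sum_insert (by simp)]
      have : 1 / (((N + 1 : ℕ) : ℝ) * ((N + 1 : ℕ) - 1)) = 1 / N - 1 / (N + 1 : ℕ) := by
        push_cast
        have h1 : (N : ℝ) + 1 - 1 = N := by ring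
        rw [h1]
        field_simp
        ring
      rw [this]; linarith
  rcases Nat.eq_zero_or_pos N with rfl | hN
  · simp
  refine le_trans (Finset.sum_le_sum_of_subset_of_nonneg (t := Ioc 1 N) ?_ ?_) ((h N hN).trans ?_)
  · intro p hp
    rw [mem_Ioc]
    exact ⟨(Nat.prime_of_mem_primesLE hp).one_lt, Nat.le_of_mem_primesLE hp⟩
  · intro p hp _
    rw [mem_Ioc] at hp
    have : (1 : ℝ) < p := by exact_mod_cast hp.1
    have : (0 : ℝ) < p - 1 := by linarith
    positivity
  · have : (0 : ℝ) ≤ 1 / N := by positivity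
    linarith

lemma aux_prime_factor_le {p : ℕ} (hp : p.Prime) :
    (1 - 1 / (p : ℝ))⁻¹ ≤ Real.exp (1 / p + 1 / ((p : ℝ) * (p - 1))) := by
  have h1 : (1 : ℝ) < p := by exact_mod_cast hp.one_lt
  have h2 : (0 : ℝ) < p - 1 := by linarith
  have e : (1 - 1 / (p : ℝ))⁻¹ = (1 / p + 1 / ((p : ℝ) * (p - 1))) + 1 := by
    have : (1 - 1 / (p : ℝ)) = (p - 1) / p := by field_simp
    rw [this, inv_div]
    field_simp
    ring
  rw [e]
  exact Real.add_one_le_exp _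

lemma aux_one_sub_pos {p : ℕ} (hp : p.Prime) : (0 : ℝ) < 1 - 1 / p := by
  have h1 : (1 : ℝ) < p := by exact_mod_cast hp.one_lt
  rw [sub_pos, div_lt_one (by linarith)]
  exact h1

lemma aux_one_sub_le {p : ℕ} : (1 : ℝ) - 1 / p ≤ 1 := by
  have : (0 : ℝ) ≤ 1 / p := by positivity
  linarith

/-- Mertens' third theorem, upper bound -/
lemma aux_mertens3 : ∃ C : ℝ, 0 < C ∧ ∀ N : ℕ, 2 ≤ N →
    ∏ p ∈ N.primesLE, (1 - 1 / (p : ℝ))⁻¹ ≤ C * Real.log N := by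
  obtain ⟨C, hC, hM⟩ := aux_mertens2
  refine ⟨Real.exp (C + 1), by positivity, fun N hN => ?_⟩
  have l1 : 0 < Real.log N := Real.log_pos (by exact_mod_cast hN)
  calc ∏ p ∈ N.primesLE, (1 - 1 / (p : ℝ))⁻¹
      ≤ ∏ p ∈ N.primesLE, Real.exp (1 / p + 1 / ((p : ℝ) * (p - 1))) := by
        refine Finset.prod_le_prod (fun p hp => ?_) (fun p hp => ?_)
        · exact (inv_pos.2 (aux_one_sub_pos (Nat.prime_of_mem_primesLE hp))).le
        · exact aux_prime_factor_le (Nat.prime_of_mem_primesLE hp)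
    _ = Real.exp (∑ p ∈ N.primesLE, 1 / (p : ℝ) + ∑ p ∈ N.primesLE, 1 / ((p : ℝ) * (p - 1))) := by
        rw [← Real.exp_sum, Finset.sum_add_distrib]
    _ ≤ Real.exp (Real.log (Real.log N) + (C + 1)) := by
        apply Real.exp_le_exp.2
        have := hM N hN
        have := aux_sum_inv N
        linarith
    _ = _ := by
        rw [Real.exp_add, Real.exp_log l1, mul_comm]

/-- Local Euler factor. -/
lemma aux_euler_factor {p : ℕ} (hp : p.Prime) :
    HasSum (fun n : ℕ => 1 / ((p ^ n).totient : ℝ))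
      ((1 - 1 / (p : ℝ))⁻¹ * (1 + 1 / ((p : ℝ) * (p - 1)))) := by
  have h1 : (1 : ℝ) < p := by exact_mod_cast hp.one_lt
  have h2 : (0 : ℝ) < p - 1 := by linarith
  rw [← hasSum_nat_add_iff' 1]
  have h3 := (hasSum_geometric_of_lt_one (r := 1 / (p : ℝ)) (by positivity)
    (by rw [div_lt_one (by linarith)]; exact h1)).mul_left (1 / ((p : ℝ) - 1))
  have e1 : (fun n : ℕ => 1 / ((p ^ (n + 1)).totient : ℝ))
      = fun i => 1 / ((p : ℝ) - 1) * (1 / (p : ℝ)) ^ i := by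
    funext n
    rw [Nat.totient_prime_pow_succ hp]
    push_cast [Nat.cast_sub hp.one_lt.le]
    rw [one_div_pow]
    field_simp
  rw [e1]
  have e2 : (1 - 1 / (p : ℝ))⁻¹ * (1 + 1 / ((p : ℝ) * (p - 1)))
      - ∑ i ∈ range 1, 1 / ((p ^ i).totient : ℝ) = 1 / ((p : ℝ) - 1) * (1 - 1 / (p : ℝ))⁻¹ := by
    have : (1 - 1 / (p : ℝ)) = (p - 1) / p := by field_simp
    rw [this, inv_div]
    simp only [Finset.range_one, Finset.sum_singleton, pow_zero, Nat.totient_one, Nat.cast_one]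
    field_simp
    ring
  rw [e2]
  exact h3

noncomputable def auxV (t N : ℕ) : ℝ := ∏ p ∈ N.primesLE with p ∣ t, (1 - 1 / (p : ℝ))

lemma auxV_nonneg (t N : ℕ) : 0 ≤ auxV t N := by
  refine Finset.prod_nonneg fun p hp => ?_
  rw [Finset.mem_filter] at hp
  exact (aux_one_sub_pos (Nat.prime_of_mem_primesLE hp.1)).le

lemma auxV_anti (t : ℕ) {N M : ℕ} (h : N ≤ M) : auxV t M ≤ auxV t N := by
  unfold auxV
  refine Finset.prod_le_prod_of_subset_of_le_one ?_ ?_ ?_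
  · refine Finset.filter_subset_filter _ ?_
    intro p hp
    rw [Nat.mem_primesLE] at hp ⊢
    exact ⟨hp.1.trans h, hp.2⟩
  · intro p hp
    rw [Finset.mem_filter] at hp
    exact (aux_one_sub_pos (Nat.prime_of_mem_primesLE hp.1)).le
  · intro p _ _
    exact aux_one_sub_le

lemma aux_F : ∃ C : ℝ, 0 < C ∧ ∀ t N : ℕ, 2 ≤ N →
    ∑ c ∈ Ioc 0 N with c.Coprime t, 1 / (c.totient : ℝ) ≤ C * Real.log N * auxV t N := by
  obtain ⟨C, hC, hM⟩ := aux_mertens3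
  refine ⟨C * Real.exp 1, by positivity, fun t N hN => ?_⟩
  set s := N.primesLE.filter (fun p => ¬ p ∣ t) with hs
  have hsp : ∀ p ∈ s, p.Prime := fun p hp => Nat.prime_of_mem_primesLE (Finset.mem_filter.1 hp).1
  have hE := EulerProduct.summable_and_hasSum_factoredNumbers_prod_filter_prime_tsum
    (f := fun n : ℕ => 1 / (n.totient : ℝ)) (by simp)
    (fun {m n} hmn => by rw [Nat.totient_mul hmn]; push_cast; rw [one_div_mul_one_div])
    (fun {p} hp => (aux_euler_factor hp).summable.norm) s
  have hsf : s.filter Nat.Prime = s := Finset.filter_true_of_mem hsp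
  rw [hsf] at hE
  have h1 : ∑ c ∈ Ioc 0 N with c.Coprime t, 1 / (c.totient : ℝ)
      ≤ ∏ p ∈ s, ∑' n : ℕ, 1 / ((p ^ n).totient : ℝ) := by
    have h2 := hE.2
    replace h2 := (hasSum_subtype_iff_indicator (f := fun n : ℕ => 1 / (n.totient : ℝ))).1 h2
    have h3 := sum_le_hasSum (Finset.filter (fun c => c.Coprime t) (Ioc 0 N)) (fun i _ => by
      apply Set.indicator_nonneg; intro _ _; positivity) h2
    refine le_trans (le_of_eq ?_) h3
    refine Finset.sum_congr rfl fun c hc => ?_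
    rw [Set.indicator_of_mem]
    simp only [Finset.mem_filter, mem_Ioc] at hc
    rw [Nat.mem_factoredNumbers']
    intro p hp hpc
    rw [hs, Finset.mem_filter, Nat.mem_primesLE]
    refine ⟨⟨(Nat.le_of_dvd hc.1.1 hpc).trans hc.1.2, hp⟩, fun hpt => ?_⟩
    exact hp.one_lt.ne' (Nat.dvd_one.1 (hc.2 ▸ Nat.dvd_gcd hpc hpt))
  have h2 : ∏ p ∈ s, ∑' n : ℕ, 1 / ((p ^ n).totient : ℝ)
      = (∏ p ∈ s, (1 - 1 / (p : ℝ))⁻¹) * ∏ p ∈ s, (1 + 1 / ((p : ℝ) * (p - 1))) := by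
    rw [← Finset.prod_mul_distrib]
    exact Finset.prod_congr rfl fun p hp => (aux_euler_factor (hsp p hp)).tsum_eq
  have hnn : ∀ p : ℕ, p.Prime → 0 ≤ 1 / ((p : ℝ) * (p - 1)) := by
    intro p hp
    have h1 : (1 : ℝ) < p := by exact_mod_cast hp.one_lt
    have h2 : (0 : ℝ) < p - 1 := by linarith
    positivity
  have h3 : ∏ p ∈ s, (1 + 1 / ((p : ℝ) * (p - 1))) ≤ Real.exp 1 := by
    calc ∏ p ∈ s, (1 + 1 / ((p : ℝ) * (p - 1))) ≤ ∏ p ∈ s, Real.exp (1 / ((p : ℝ) * (p - 1))) := by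
          refine Finset.prod_le_prod (fun p hp => ?_) (fun p hp => ?_)
          · have := hnn p (hsp p hp)
            linarith
          · rw [add_comm]; exact Real.add_one_le_exp _
      _ = Real.exp (∑ p ∈ s, (1 / ((p : ℝ) * (p - 1)))) := by rw [Real.exp_sum]
      _ ≤ Real.exp 1 := by
          apply Real.exp_le_exp.2
          refine le_trans ?_ (aux_sum_inv N)
          refine Finset.sum_le_sum_of_subset_of_nonneg (Finset.filter_subset _ _) ?_
          intro p hp _
          exact hnn p (Nat.prime_of_mem_primesLE hp)
  have h4 : ∏ p ∈ s, (1 - 1 / (p : ℝ))⁻¹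
      = (∏ p ∈ N.primesLE, (1 - 1 / (p : ℝ))⁻¹) * auxV t N := by
    rw [← Finset.prod_filter_mul_prod_filter_not N.primesLE (fun p => p ∣ t), auxV, ← hs,
      mul_right_comm, ← Finset.prod_mul_distrib]
    symm
    convert one_mul _ using 2
    refine Finset.prod_eq_one ?_
    intro p hp
    rw [Finset.mem_filter] at hp
    exact inv_mul_cancel₀ (aux_one_sub_pos (Nat.prime_of_mem_primesLE hp.1)).ne'
  have hV := auxV_nonneg t N
  have hm := hM N hN
  have h5 : 0 ≤ ∏ p ∈ s, (1 - 1 / (p : ℝ))⁻¹ :=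
    Finset.prod_nonneg fun p hp => (inv_pos.2 (aux_one_sub_pos (hsp p hp))).le
  rw [h2] at h1
  calc _ ≤ _ := h1
    _ ≤ (∏ p ∈ s, (1 - 1 / (p : ℝ))⁻¹) * Real.exp 1 := mul_le_mul_of_nonneg_left h3 h5
    _ ≤ (C * Real.log N * auxV t N) * Real.exp 1 := by
        rw [h4]
        gcongr
    _ = _ := by ring

noncomputable def auxG (t N : ℕ) : ℝ := ∑ c ∈ Ioc 0 N with c.Coprime t, (c : ℝ) / (c.totient : ℝ)

lemma auxG_nonneg (t N : ℕ) : 0 ≤ auxG t N := Finset.sum_nonneg fun _ _ => by positivity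

lemma aux_pp_ratio {d : ℕ} (hd : IsPrimePow d) : (d : ℝ) / d.totient ≤ 2 := by
  rw [isPrimePow_nat_iff] at hd
  obtain ⟨p, k, hp, hk, rfl⟩ := hd
  rw [Nat.totient_prime_pow hp hk]
  have h2 : (2 : ℝ) ≤ p := by exact_mod_cast hp.two_le
  have hs : p ^ k = p ^ (k - 1) * p := by rw [← pow_succ]; congr 1; omega
  rw [hs]
  push_cast [Nat.cast_sub hp.one_lt.le]
  have h3 : (0 : ℝ) < p ^ (k - 1) := by positivity
  rw [mul_div_mul_left _ _ h3.ne', div_le_iff₀ (by linarith)]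
  linarith

lemma aux_HR : ∃ C : ℝ, 0 < C ∧ ∀ t N : ℕ, 0 < N →
    auxG t N * Real.log N ≤ C * N * ∑ c ∈ Ioc 0 N with c.Coprime t, 1 / (c.totient : ℝ) := by
  obtain ⟨C, hC, hCh⟩ := aux_cheb
  refine ⟨2 * C + 1, by positivity, fun t N hN => ?_⟩
  have hN' : (0 : ℝ) < N := by exact_mod_cast hN
  let f : ℕ → ℝ := fun c => if c.Coprime t then (c : ℝ) / c.totient else 0
  have hf0 : ∀ c, 0 ≤ f c := fun c => by simp only [f]; split_ifs <;> positivity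
  have hF : ∑ c ∈ Ioc 0 N with c.Coprime t, 1 / (c.totient : ℝ) = ∑ c ∈ Ioc 0 N, f c / c := by
    rw [Finset.sum_filter]
    refine Finset.sum_congr rfl fun c hc => ?_
    rw [mem_Ioc] at hc
    have : (c : ℝ) ≠ 0 := by exact_mod_cast hc.1.ne'
    simp only [f]
    split_ifs
    · field_simp
    · simp
  have hG : auxG t N = ∑ c ∈ Ioc 0 N, f c := by
    rw [auxG, Finset.sum_filter]
  rw [hF, hG]
  have hsub : ∀ d e : ℕ, 0 < d → 0 < e → ArithmeticFunction.vonMangoldt d * f (d * e)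
      ≤ ArithmeticFunction.vonMangoldt d * (2 * f e) := by
    intro d e hd he
    by_cases hpp : IsPrimePow d
    · refine mul_le_mul_of_nonneg_left ?_ ArithmeticFunction.vonMangoldt_nonneg
      by_cases hcop : (d * e).Coprime t
      · have he' : e.Coprime t := Nat.Coprime.coprime_mul_left hcop
        have f1 : f (d * e) = ((d * e : ℕ) : ℝ) / (d * e).totient := if_pos hcop
        have f2 : f e = (e : ℝ) / e.totient := if_pos he'
        rw [f1, f2]
        have h1 := aux_pp_ratio hpp
        have h2 : ((d.totient * e.totient : ℕ) : ℝ) ≤ (d * e).totient := by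
          exact_mod_cast Nat.totient_super_multiplicative d e
        have h3 : (0 : ℝ) < d.totient := by exact_mod_cast Nat.totient_pos.2 hd
        have h4 : (0 : ℝ) < e.totient := by exact_mod_cast Nat.totient_pos.2 he
        push_cast at h2 ⊢
        calc (d : ℝ) * e / (d * e).totient ≤ (d : ℝ) * e / (d.totient * e.totient) := by
              gcongr
          _ = (d / d.totient) * (e / e.totient) := by field_simp
          _ ≤ _ := by gcongr
      · have f1 : f (d * e) = 0 := if_neg hcop
        rw [f1]
        exact mul_nonneg zero_le_two (hf0 e)
    · rw [ArithmeticFunction.vonMangoldt_eq_zero_iff.2 hpp]; simp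
  have h1 : ∑ c ∈ Ioc 0 N, f c * Real.log c ≤ 2 * C * N * ∑ c ∈ Ioc 0 N, f c / c := by
    rw [aux_swap_log, Finset.mul_sum]
    refine Finset.sum_le_sum fun e he => ?_
    rw [mem_Ioc] at he
    calc ∑ d ∈ Ioc 0 (N / e), ArithmeticFunction.vonMangoldt d * f (d * e)
        ≤ ∑ d ∈ Ioc 0 (N / e), ArithmeticFunction.vonMangoldt d * (2 * f e) :=
          Finset.sum_le_sum fun d hd => hsub d e (mem_Ioc.1 hd).1 he.1
      _ = (∑ d ∈ Ioc 0 (N / e), ArithmeticFunction.vonMangoldt d) * (2 * f e) := by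
          rw [Finset.sum_mul]
      _ ≤ (C * (N / e : ℝ)) * (2 * f e) :=
          mul_le_mul_of_nonneg_right (hCh N e he.1) (mul_nonneg zero_le_two (hf0 e))
      _ = _ := by ring
  have h2 : ∑ c ∈ Ioc 0 N, f c * (Real.log N - Real.log c) ≤ N * ∑ c ∈ Ioc 0 N, f c / c := by
    rw [Finset.mul_sum]
    refine Finset.sum_le_sum fun c hc => ?_
    rw [mem_Ioc] at hc
    have hc' : (0 : ℝ) < c := by exact_mod_cast hc.1
    have : Real.log N - Real.log c ≤ N / c := by
      rw [← Real.log_div hN'.ne' hc'.ne']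
      have := Real.log_le_sub_one_of_pos (div_pos hN' hc')
      linarith
    calc f c * (Real.log N - Real.log c) ≤ f c * (N / c) :=
          mul_le_mul_of_nonneg_left this (hf0 c)
      _ = _ := by ring
  have h3 : (∑ c ∈ Ioc 0 N, f c) * Real.log N = ∑ c ∈ Ioc 0 N, f c * Real.log c
      + ∑ c ∈ Ioc 0 N, f c * (Real.log N - Real.log c) := by
    rw [← Finset.sum_add_distrib, Finset.sum_mul]
    refine Finset.sum_congr rfl fun c _ => by ring
  rw [h3]
  linarith

lemma aux_G_le : ∃ C : ℝ, 0 < C ∧ ∀ t N : ℕ, 2 ≤ N → auxG t N ≤ C * N * auxV t N := by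
  obtain ⟨C, hC, h1⟩ := aux_HR
  obtain ⟨D, hD, h2⟩ := aux_F
  refine ⟨C * D, by positivity, fun t N hN => ?_⟩
  have l1 : 0 < Real.log N := Real.log_pos (by exact_mod_cast hN)
  have h3 := h1 t N (by omega)
  have h4 := h2 t N hN
  have h5 : auxG t N * Real.log N ≤ (C * D * N * auxV t N) * Real.log N := by
    refine h3.trans ?_
    calc _ ≤ C * N * (D * Real.log N * auxV t N) := by gcongr
      _ = _ := by ring
  exact le_of_mul_le_mul_right h5 l1

lemma aux_geom (K : ℕ) : ∑ k ∈ Icc 1 K, Real.exp k ≤ 2 * Real.exp K := by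
  induction K with
  | zero => simp
  | succ K ih =>
    rw [← Finset.insert_Icc_right_eq_Icc_add_one (by omega), Finset.sum_insert (by simp)]
    have : 2 * Real.exp K ≤ Real.exp (K + 1 : ℕ) := by
      push_cast
      rw [Real.exp_add, mul_comm]
      have := Real.add_one_le_exp 1
      have h2 := Real.exp_pos K
      nlinarith
    linarith

lemma aux_geom_filter (K : ℕ) (Y : ℝ) (hY : 0 < Y) :
    ∑ k ∈ Icc 1 K with Real.exp (k : ℕ) ≤ Y, Real.exp (k : ℕ) ≤ 2 * Y := by
  rcases ((Icc 1 K).filter (fun k : ℕ => Real.exp k ≤ Y)).eq_empty_or_nonempty with h | h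
  · rw [h]; simp; linarith
  · set M := ((Icc 1 K).filter (fun k : ℕ => Real.exp k ≤ Y)).max' h
    have hM := Finset.mem_filter.1 (Finset.max'_mem _ h)
    calc _ ≤ ∑ k ∈ Icc 1 M, Real.exp (k : ℕ) := by
          refine Finset.sum_le_sum_of_subset_of_nonneg ?_ (fun _ _ _ => (Real.exp_pos _).le)
          intro k hk
          have := Finset.le_max' _ k hk
          rw [Finset.mem_filter, Finset.mem_Icc] at hk
          rw [Finset.mem_Icc]
          exact ⟨hk.1.1, this⟩
      _ ≤ 2 * Real.exp M := aux_geom M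
      _ ≤ _ := by linarith [hM.2]

lemma aux_avg : ∃ C : ℝ, 0 < C ∧ ∀ (t K : ℕ) (X : ℝ), 1 ≤ K → 0 < X →
    ∑ k ∈ Icc 1 K, Real.exp k / X * auxG t ⌊X / Real.exp k⌋₊
      ≤ C * K * auxV t ⌊Real.exp K⌋₊ := by
  obtain ⟨C, hC, h1⟩ := aux_G_le
  obtain ⟨D, hD, h2⟩ := aux_F
  refine ⟨C + 2 * D, by positivity, fun t K X hK hX => ?_⟩
  set Z := ⌊Real.exp K⌋₊ with hZ
  have hZ2 : 2 ≤ Z := by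
    apply Nat.le_floor
    have := Real.add_one_le_exp (K : ℝ)
    have : (1 : ℝ) ≤ K := by exact_mod_cast hK
    push_cast; linarith
  have hV := auxV_nonneg t Z
  have hlogZ : Real.log Z ≤ K := by
    rw [Real.log_le_iff_le_exp (by positivity)]
    exact Nat.floor_le (Real.exp_pos _).le
  -- pointwise bound
  have hpt : ∀ k ∈ Icc 1 K, Real.exp k / X * auxG t ⌊X / Real.exp k⌋₊
      ≤ C * auxV t Z + Real.exp k / X * ∑ c ∈ Ioc 0 Z with c.Coprime t,
        (if Real.exp (k : ℕ) ≤ X / c then (c : ℝ) / c.totient else 0) := by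
    intro k hk
    have hek := Real.exp_pos k
    have hy : 0 < X / Real.exp k := by positivity
    by_cases hlt : X / Real.exp k < Real.exp K
    · have : auxG t ⌊X / Real.exp k⌋₊ ≤ ∑ c ∈ Ioc 0 Z with c.Coprime t,
        (if Real.exp (k : ℕ) ≤ X / c then (c : ℝ) / c.totient else 0) := by
        rw [← Finset.sum_filter, auxG]
        refine Finset.sum_le_sum_of_subset_of_nonneg ?_ (fun _ _ _ => by positivity)
        intro c hc
        simp only [Finset.mem_filter, mem_Ioc] at hc ⊢
        have hc0 : (0 : ℝ) < c := by exact_mod_cast hc.1.1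
        refine ⟨⟨⟨hc.1.1, hc.1.2.trans (Nat.floor_mono hlt.le)⟩, hc.2⟩, ?_⟩
        have := (Nat.le_floor_iff hy.le).1 hc.1.2
        rw [le_div_iff₀ hek] at this
        rw [le_div_iff₀ hc0]
        linarith
      have h3 : Real.exp k / X * auxG t ⌊X / Real.exp k⌋₊ ≤ Real.exp k / X *
        ∑ c ∈ Ioc 0 Z with c.Coprime t,
        (if Real.exp (k : ℕ) ≤ X / c then (c : ℝ) / c.totient else 0) := by gcongr
      have : 0 ≤ C * auxV t Z := by positivity
      linarith
    · push Not at hlt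
      have hle : Z ≤ ⌊X / Real.exp k⌋₊ := Nat.floor_mono hlt
      have h3 := h1 t _ (hZ2.trans hle)
      have h4 := auxV_anti t hle
      have h5 := Nat.floor_le hy.le
      have h6 : Real.exp k / X * auxG t ⌊X / Real.exp k⌋₊ ≤ C * auxV t Z := by
        calc _ ≤ Real.exp k / X * (C * (X / Real.exp k) * auxV t Z) := by
              have := auxV_nonneg t ⌊X / Real.exp k⌋₊
              gcongr
              refine h3.trans ?_
              gcongr
          _ = _ := by field_simp
      have : 0 ≤ Real.exp k / X * ∑ c ∈ Ioc 0 Z with c.Coprime t,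
        (if Real.exp (k : ℕ) ≤ X / c then (c : ℝ) / c.totient else 0) := by
        refine mul_nonneg (by positivity) (Finset.sum_nonneg fun c _ => ?_)
        split_ifs <;> positivity
      linarith
  refine (Finset.sum_le_sum hpt).trans ?_
  rw [Finset.sum_add_distrib]
  have h3 : ∑ k ∈ Icc 1 K, Real.exp k / X * ∑ c ∈ Ioc 0 Z with c.Coprime t,
        (if Real.exp (k : ℕ) ≤ X / c then (c : ℝ) / c.totient else 0)
      ≤ 2 * (D * K * auxV t Z) := by
    simp_rw [Finset.mul_sum]
    rw [Finset.sum_comm]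
    calc _ ≤ ∑ c ∈ Ioc 0 Z with c.Coprime t, 2 * (1 / (c.totient : ℝ)) := by
          refine Finset.sum_le_sum fun c hc => ?_
          simp only [Finset.mem_filter, mem_Ioc] at hc
          have hc0 : (0 : ℝ) < c := by exact_mod_cast hc.1.1
          have hg := aux_geom_filter K (X / c) (by positivity)
          have : ∑ k ∈ Icc 1 K, Real.exp k / X *
              (if Real.exp (k : ℕ) ≤ X / c then (c : ℝ) / c.totient else 0)
              = (c / c.totient / X) * ∑ k ∈ Icc 1 K with Real.exp (k : ℕ) ≤ X / c,
                Real.exp (k : ℕ) := by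
            rw [Finset.sum_filter, Finset.mul_sum]
            refine Finset.sum_congr rfl fun k _ => ?_
            split_ifs
            · ring
            · simp
          rw [this]
          calc _ ≤ (c / c.totient / X : ℝ) * (2 * (X / c)) := by gcongr
            _ = _ := by field_simp
      _ = 2 * ∑ c ∈ Ioc 0 Z with c.Coprime t, 1 / (c.totient : ℝ) := by rw [Finset.mul_sum]
      _ ≤ 2 * (D * Real.log Z * auxV t Z) := by
          have := h2 t Z hZ2
          linarith
      _ ≤ _ := by gcongr
  have h4 : ∑ k ∈ Icc 1 K, C * auxV t Z = K * (C * auxV t Z) := by simp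
  rw [h4]
  linarith

lemma aux_V_tail (ε : ℝ) (hε : 0 < ε) : ∃ C : ℝ, 0 < C ∧ ∀ (h t : ℕ), 0 < t → t < 2 ^ (8 * 4 ^ h) →
    1 ≤ ⌊ε * h * Real.log 4⌋₊ →
    auxV t ⌊Real.exp ⌊ε * h * Real.log 4⌋₊⌋₊ ≤ C * (t.totient / t) := by
  obtain ⟨C1, hC1, hM⟩ := aux_mertens1
  refine ⟨Real.exp (2 * (2 / ε + C1 + 8)), by positivity, fun h t ht htlt hK => ?_⟩
  set K := ⌊ε * h * Real.log 4⌋₊ with hKdef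
  set Z := ⌊Real.exp K⌋₊ with hZ
  set W : ℕ := 4 ^ h with hW
  have hW0 : 0 < W := by positivity
  have hW0' : (0 : ℝ) < W := by exact_mod_cast hW0
  have hK1 : (1 : ℝ) ≤ K := by exact_mod_cast hK
  have hlogW : Real.log W = h * Real.log 4 := by
    rw [hW]; push_cast; rw [Real.log_pow]
  have hlogWK : Real.log W / K ≤ 2 / ε := by
    have h1 := Nat.lt_floor_add_one (ε * h * Real.log 4)
    rw [← hKdef] at h1
    rw [hlogW, div_le_div_iff₀ (by linarith) hε]
    linarith
  set B := t.primeFactors.filter (fun p => ¬ p ≤ Z) with hB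
  have hBp : ∀ p ∈ B, p.Prime := fun p hp => Nat.prime_of_mem_primeFactors (Finset.mem_filter.1 hp).1
  have e1 : (t.totient : ℝ) / t = auxV t Z * ∏ p ∈ B, (1 - 1 / (p : ℝ)) := by
    have h1 := Nat.totient_eq_mul_prod_factors t
    have h2 : (t.totient : ℝ) = t * ∏ p ∈ t.primeFactors, (1 - (p : ℝ)⁻¹) := by
      have h3 := congrArg (Rat.cast : ℚ → ℝ) h1
      push_cast at h3
      exact h3
    rw [h2, mul_div_cancel_left₀ _ (by positivity),
      ← Finset.prod_filter_mul_prod_filter_not t.primeFactors (fun p => p ≤ Z), auxV]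
    simp only [one_div]
    congr 1
    refine Finset.prod_congr ?_ fun _ _ => rfl
    ext p
    simp only [Finset.mem_filter, Nat.mem_primesLE, Nat.mem_primeFactors]
    constructor
    · rintro ⟨⟨a, b, c⟩, d⟩; exact ⟨⟨d, a⟩, b⟩
    · rintro ⟨⟨d, a⟩, b⟩; exact ⟨⟨a, b, ht.ne'⟩, d⟩
  have hsum : ∑ p ∈ B, 1 / (p : ℝ) ≤ 2 / ε + C1 + 8 := by
    rw [← Finset.sum_filter_add_sum_filter_not B (fun p => p ≤ W)]
    have s1 : ∑ p ∈ B with p ≤ W, 1 / (p : ℝ) ≤ 2 / ε + C1 := by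
      calc ∑ p ∈ B with p ≤ W, 1 / (p : ℝ) ≤ ∑ p ∈ B with p ≤ W, (Real.log p / p) / K := by
            refine Finset.sum_le_sum fun p hp => ?_
            rw [Finset.mem_filter, hB, Finset.mem_filter] at hp
            have hpp := Nat.prime_of_mem_primeFactors hp.1.1
            have hp0 : (0 : ℝ) < p := by exact_mod_cast hpp.pos
            have : Real.exp K < p := (Nat.floor_lt (Real.exp_pos _).le).1 (not_le.1 hp.1.2)
            have : (K : ℝ) ≤ Real.log p := by
              rw [Real.le_log_iff_exp_le hp0]; exact this.le
            rw [div_div, div_le_div_iff₀ hp0 (by positivity)]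
            nlinarith
        _ ≤ ∑ p ∈ W.primesLE, (Real.log p / p) / K := by
            refine Finset.sum_le_sum_of_subset_of_nonneg ?_ ?_
            · intro p hp
              rw [Finset.mem_filter] at hp
              rw [Nat.mem_primesLE]
              exact ⟨hp.2, hBp p hp.1⟩
            · intro p _ _
              have := Real.log_natCast_nonneg p
              positivity
        _ = (∑ p ∈ W.primesLE, (Real.log p / p)) / K := by rw [Finset.sum_div]
        _ ≤ (Real.log W + C1) / K := by
            have := hM W hW0
            gcongr
        _ = Real.log W / K + C1 / K := by ring
        _ ≤ _ := by
            have : C1 / K ≤ C1 := div_le_self hC1.le hK1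
            linarith
    have s2 : ∑ p ∈ B with ¬ p ≤ W, 1 / (p : ℝ) ≤ 8 := by
      have hcard : (t.primeFactors.card : ℝ) ≤ 8 * W := by
        have h1 : 2 ^ t.primeFactors.card ≤ t := by
          calc 2 ^ t.primeFactors.card ≤ ∏ p ∈ t.primeFactors, p :=
                Finset.pow_card_le_prod _ _ _ fun p hp => (Nat.prime_of_mem_primeFactors hp).two_le
            _ ≤ t := Nat.le_of_dvd ht (Nat.prod_primeFactors_dvd t)
        have := (Nat.pow_lt_pow_iff_right (by norm_num)).1 (h1.trans_lt htlt)
        exact_mod_cast this.le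
      calc ∑ p ∈ B with ¬ p ≤ W, 1 / (p : ℝ) ≤ ∑ p ∈ B with ¬ p ≤ W, 1 / (W : ℝ) := by
            refine Finset.sum_le_sum fun p hp => ?_
            rw [Finset.mem_filter] at hp
            apply one_div_le_one_div_of_le hW0'
            exact_mod_cast (not_le.1 hp.2).le
        _ ≤ ∑ p ∈ t.primeFactors, 1 / (W : ℝ) := by
            refine Finset.sum_le_sum_of_subset_of_nonneg ?_ (fun _ _ _ => by positivity)
            exact (Finset.filter_subset _ _).trans (Finset.filter_subset _ _)
        _ = t.primeFactors.card / W := by simp [div_eq_mul_inv]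
        _ ≤ 8 := by
            rw [div_le_iff₀ hW0']
            exact hcard
    linarith
  have hprod : ∏ p ∈ B, (1 - 1 / (p : ℝ))⁻¹ ≤ Real.exp (2 * (2 / ε + C1 + 8)) := by
    calc ∏ p ∈ B, (1 - 1 / (p : ℝ))⁻¹ ≤ ∏ p ∈ B, Real.exp (2 * (1 / p)) := by
          refine Finset.prod_le_prod (fun p hp => ?_) (fun p hp => ?_)
          · exact (inv_pos.2 (aux_one_sub_pos (hBp p hp))).le
          · refine (aux_prime_factor_le (hBp p hp)).trans (Real.exp_le_exp.2 ?_)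
            have h2 : (2 : ℝ) ≤ p := by exact_mod_cast (hBp p hp).two_le
            have : 1 / ((p : ℝ) * (p - 1)) ≤ 1 / p := by
              apply one_div_le_one_div_of_le (by linarith)
              nlinarith
            linarith
      _ = Real.exp (2 * ∑ p ∈ B, 1 / (p : ℝ)) := by rw [← Real.exp_sum, Finset.mul_sum]
      _ ≤ _ := Real.exp_le_exp.2 (by linarith)
  have hPpos : 0 < ∏ p ∈ B, (1 - 1 / (p : ℝ)) :=
    Finset.prod_pos fun p hp => aux_one_sub_pos (hBp p hp)
  rw [Finset.prod_inv_distrib, inv_le_iff_one_le_mul₀ hPpos] at hprod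
  rw [e1]
  have hV := auxV_nonneg t Z
  nlinarith

noncomputable def auxA (x y u v : ℤ) (g : ℕ) : ℕ :=
  Nat.card {s : ZMod g // IsUnit ((x : ZMod g) + u * s) ∧ IsUnit ((y : ZMod g) + v * s)}

lemma auxA_mul (x y u v : ℤ) {a b : ℕ} (h : a.Coprime b) :
    auxA x y u v (a * b) = auxA x y u v a * auxA x y u v b := by
  unfold auxA
  rw [← Nat.card_prod]
  let e := ZMod.chineseRemainder h
  have key : ∀ (z w : ℤ) (s : ZMod (a * b)), IsUnit ((z : ZMod (a * b)) + w * s) ↔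
      IsUnit ((z : ZMod a) + w * (e s).1) ∧ IsUnit ((z : ZMod b) + w * (e s).2) := by
    intro z w s
    rw [← MulEquiv.isUnit_map e, Prod.isUnit_iff]
    simp
  refine Nat.card_congr ?_
  refine (Equiv.subtypeEquiv (q := fun q : ZMod a × ZMod b =>
    (IsUnit ((x : ZMod a) + u * q.1) ∧ IsUnit ((y : ZMod a) + v * q.1)) ∧
    (IsUnit ((x : ZMod b) + u * q.2) ∧ IsUnit ((y : ZMod b) + v * q.2))) e.toEquiv ?_).trans ?_
  · intro s
    rw [key, key]
    simp only [RingEquiv.toEquiv_eq_coe, EquivLike.coe_coe]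
    tauto
  · exact Equiv.subtypeProdEquivProd
      (p := fun s : ZMod a => IsUnit ((x : ZMod a) + u * s) ∧ IsUnit ((y : ZMod a) + v * s))
      (q := fun s : ZMod b => IsUnit ((x : ZMod b) + u * s) ∧ IsUnit ((y : ZMod b) + v * s))

lemma auxA_pow (x y u v : ℤ) {p k : ℕ} (hp : p.Prime) :
    auxA x y u v (p ^ (k + 1)) ≤ p ^ k * auxA x y u v p := by
  classical
  have : NeZero p := ⟨hp.ne_zero⟩
  have : NeZero (p ^ (k + 1)) := ⟨pow_ne_zero _ hp.ne_zero⟩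
  unfold auxA
  rw [Nat.card_eq_fintype_card, Nat.card_eq_fintype_card, Fintype.card_subtype, Fintype.card_subtype]
  let f : ZMod (p ^ (k + 1)) →+* ZMod p := ZMod.castHom (dvd_pow_self p (by omega)) (ZMod p)
  refine Finset.card_le_mul_card_image_of_maps_to (f := f) ?_ _ ?_
  · intro s hs
    simp only [Finset.mem_filter, Finset.mem_univ, true_and] at hs ⊢
    have h1 := hs.1.map f
    have h2 := hs.2.map f
    simp only [map_add, map_mul, map_intCast] at h1 h2
    exact ⟨h1, h2⟩
  · intro b _
    calc _ ≤ (Finset.range (p ^ k)).card := by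
          refine Finset.card_le_card_of_injOn (fun a => a.val / p) ?_ ?_
          · intro a _
            simp only [Finset.coe_range, Set.mem_Iio]
            rw [Nat.div_lt_iff_lt_mul hp.pos, ← pow_succ]
            exact ZMod.val_lt a
          · intro a ha a' ha' heq
            simp only [Finset.coe_filter, Set.mem_ofPred_eq] at ha ha'
            have h1 : f a = f a' := ha.2.trans ha'.2.symm
            have h2 : ∀ a : ZMod (p ^ (k + 1)), f a = ((a.val : ℕ) : ZMod p) := by
              intro a
              conv_lhs => rw [← ZMod.natCast_zmod_val a]
              exact map_natCast f _
            rw [h2, h2, ZMod.natCast_eq_natCast_iff'] at h1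
            apply ZMod.val_injective
            rw [← Nat.div_add_mod a.val p, ← Nat.div_add_mod a'.val p, h1]
            simp only at heq
            rw [heq]
      _ = _ := by simp

noncomputable def auxw (d : ℤ) (p : ℕ) : ℝ :=
  if (p : ℤ) ∣ d then 1 - 1 / (p : ℝ) else (1 - 1 / (p : ℝ)) ^ 2

lemma auxA_prime (x y u v c : ℤ) {p : ℕ} (hp : p.Prime) (huv : IsCoprime u v)
    (hc : (p : ℤ) ∣ x * v - y * u - c) :
    (auxA x y u v p : ℝ) ≤ p * auxw (u * v * c) p := by
  classical
  have : Fact p.Prime := ⟨hp⟩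
  have hp1 : (1 : ℝ) < p := by exact_mod_cast hp.one_lt
  have hc' : (x : ZMod p) * v - y * u = c := by
    have := (ZMod.intCast_zmod_eq_zero_iff_dvd _ p).2 hc
    push_cast at this
    linear_combination this
  have huv' : ¬ ((u : ZMod p) = 0 ∧ (v : ZMod p) = 0) := by
    rintro ⟨h1, h2⟩
    obtain ⟨r, s, hrs⟩ := huv
    have := congrArg (Int.cast : ℤ → ZMod p) hrs
    push_cast at this
    rw [h1, h2] at this
    simp at this
  unfold auxA
  rw [Nat.card_eq_fintype_card, Fintype.card_subtype]
  simp only [isUnit_iff_ne_zero]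
  unfold auxw
  split_ifs with hd
  · -- at most p - 1
    have : ∃ s0 : ZMod p, ¬ ((x : ZMod p) + u * s0 ≠ 0 ∧ (y : ZMod p) + v * s0 ≠ 0) := by
      by_cases hu : (u : ZMod p) = 0
      · have hv : (v : ZMod p) ≠ 0 := fun hv => huv' ⟨hu, hv⟩
        refine ⟨-(y / v), fun h => h.2 ?_⟩
        field_simp
        ring
      · refine ⟨-(x / u), fun h => h.1 ?_⟩
        field_simp
        ring
    obtain ⟨s0, hs0⟩ := this
    have hsub : (Finset.univ.filter fun s : ZMod p =>
        (x : ZMod p) + u * s ≠ 0 ∧ (y : ZMod p) + v * s ≠ 0) ⊆ Finset.univ.erase s0 := by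
      intro s hs
      rw [Finset.mem_filter] at hs
      rw [Finset.mem_erase]
      refine ⟨?_, Finset.mem_univ _⟩
      rintro rfl
      exact hs0 hs.2
    have h1 := Finset.card_le_card hsub
    rw [Finset.card_erase_of_mem (Finset.mem_univ _), Finset.card_univ, ZMod.card] at h1
    have h2 : ((p - 1 : ℕ) : ℝ) = p * (1 - 1 / (p : ℝ)) := by
      rw [Nat.cast_sub hp.one_lt.le]; field_simp; simp
    rw [← h2]
    exact_mod_cast h1
  · have hd' : ((u : ZMod p) * v * c) ≠ 0 := by
      intro h
      apply hd
      rw [← ZMod.intCast_zmod_eq_zero_iff_dvd]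
      push_cast
      exact h
    have hu : (u : ZMod p) ≠ 0 := fun h => hd' (by simp [h])
    have hv : (v : ZMod p) ≠ 0 := fun h => hd' (by simp [h])
    have hcc : (c : ZMod p) ≠ 0 := fun h => hd' (by simp [h])
    have hne : -((x : ZMod p) / u) ≠ -(y / v) := by
      intro h
      apply hcc
      rw [← hc']
      have h3 := neg_injective h
      rw [div_eq_div_iff hu hv] at h3
      rw [h3]; ring
    have hsub : (Finset.univ.filter fun s : ZMod p =>
        (x : ZMod p) + u * s ≠ 0 ∧ (y : ZMod p) + v * s ≠ 0)
        ⊆ (Finset.univ.erase (-((x : ZMod p) / u))).erase (-((y : ZMod p) / v)) := by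
      intro s hs
      rw [Finset.mem_filter] at hs
      rw [Finset.mem_erase, Finset.mem_erase]
      refine ⟨?_, ?_, Finset.mem_univ _⟩
      · rintro rfl
        apply hs.2.2
        field_simp
        ring
      · rintro rfl
        apply hs.2.1
        field_simp
        ring
    have h1 := Finset.card_le_card hsub
    rw [Finset.card_erase_of_mem (by
        rw [Finset.mem_erase]; exact ⟨hne.symm, Finset.mem_univ _⟩),
      Finset.card_erase_of_mem (Finset.mem_univ _), Finset.card_univ, ZMod.card] at h1
    have h2 : ((p - 1 - 1 : ℕ) : ℝ) ≤ p * (1 - 1 / (p : ℝ)) ^ 2 := by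
      rw [Nat.sub_sub, Nat.cast_sub hp.two_le]
      have : (p : ℝ) * (1 - 1 / (p : ℝ)) ^ 2 = p - 2 + 1 / p := by field_simp; ring
      rw [this]
      have : (0 : ℝ) ≤ 1 / p := by positivity
      push_cast
      linarith
    refine le_trans ?_ h2
    exact_mod_cast h1

lemma auxw_nonneg (d : ℤ) {p : ℕ} (hp : p.Prime) : 0 ≤ auxw d p := by
  have := aux_one_sub_pos hp
  unfold auxw
  split_ifs <;> positivity

lemma auxA_le (x y u v c : ℤ) (huv : IsCoprime u v) (g : ℕ) (hg : 0 < g)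
    (hc : (g : ℤ) ∣ x * v - y * u - c) :
    (auxA x y u v g : ℝ) ≤ g * ∏ p ∈ g.primeFactors, auxw (u * v * c) p := by
  induction g using Nat.recOnPosPrimePosCoprime with
  | zero => omega
  | one =>
    simp only [Nat.primeFactors_one, Finset.prod_empty, Nat.cast_one, mul_one]
    unfold auxA
    have h1 : Nat.card (ZMod 1) = 1 := by simp
    have : Nat.card {s : ZMod 1 // IsUnit ((x : ZMod 1) + u * s) ∧ IsUnit ((y : ZMod 1) + v * s)} ≤
      Nat.card (ZMod 1) := Nat.card_le_card_of_injective _ Subtype.val_injective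
    rw [h1] at this
    exact_mod_cast this
  | prime_pow p k hp hk =>
    obtain ⟨k, rfl⟩ : ∃ j, k = j + 1 := ⟨k - 1, by omega⟩
    rw [Nat.primeFactors_prime_pow (by omega) hp, Finset.prod_singleton]
    have h1 := auxA_pow x y u v (k := k) hp
    have h2 := auxA_prime x y u v c hp huv
      ((Int.natCast_dvd_natCast.2 (dvd_pow_self p (by omega))).trans hc)
    calc (auxA x y u v (p ^ (k + 1)) : ℝ) ≤ p ^ k * auxA x y u v p := by exact_mod_cast h1
      _ ≤ p ^ k * (p * auxw (u * v * c) p) := by gcongr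
      _ = _ := by push_cast; ring
  | coprime a b ha hb hab iha ihb =>
    have h1 := iha (by omega) ((Int.natCast_dvd_natCast.2 (dvd_mul_right a b)).trans hc)
    have h2 := ihb (by omega) ((Int.natCast_dvd_natCast.2 (dvd_mul_left b a)).trans hc)
    rw [auxA_mul _ _ _ _ hab, hab.primeFactors_mul, Finset.prod_union hab.disjoint_primeFactors]
    push_cast
    calc (auxA x y u v a : ℝ) * auxA x y u v b ≤ (a * ∏ p ∈ a.primeFactors, auxw (u * v * c) p) *
          (b * ∏ p ∈ b.primeFactors, auxw (u * v * c) p) := by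
          gcongr
          exact mul_nonneg (by positivity) (Finset.prod_nonneg fun p hp =>
            auxw_nonneg _ (Nat.prime_of_mem_primeFactors hp))
      _ = _ := by ring

noncomputable def auxrho (n : ℕ) : ℝ := ∏ p ∈ n.primeFactors, (1 - 1 / (p : ℝ))

lemma aux_tot (n : ℕ) : (n.totient : ℝ) = n * auxrho n := by
  have h3 := congrArg (Rat.cast : ℚ → ℝ) (Nat.totient_eq_mul_prod_factors n)
  push_cast at h3
  rw [auxrho]
  simp only [one_div]
  exact h3

lemma auxrho_pos (n : ℕ) : 0 < auxrho n :=
  Finset.prod_pos fun _ hp => aux_one_sub_pos (Nat.prime_of_mem_primeFactors hp)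

lemma auxrho_mul (g d : ℕ) (hg : g ≠ 0) (hd : d ≠ 0) :
    auxrho (g * d) = auxrho d * ∏ p ∈ g.primeFactors with ¬ p ∣ d, (1 - 1 / (p : ℝ)) := by
  unfold auxrho
  rw [← Finset.prod_union]
  · refine Finset.prod_congr ?_ fun _ _ => rfl
    rw [Nat.primeFactors_mul hg hd]
    ext p
    simp only [Finset.mem_union, Finset.mem_filter, Nat.mem_primeFactors]
    tauto
  · rw [Finset.disjoint_left]
    intro p hp hp'
    rw [Finset.mem_filter] at hp'
    exact hp'.2 (Nat.dvd_of_mem_primeFactors hp)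

lemma auxrho_mul_le (g d : ℕ) (hg : g ≠ 0) (hd : d ≠ 0) : auxrho (g * d) ≤ auxrho g := by
  unfold auxrho
  refine Finset.prod_le_prod_of_subset_of_le_one ?_ ?_ ?_
  · exact Nat.primeFactors_mono (dvd_mul_right _ _) (mul_ne_zero hg hd)
  · exact fun p hp => (aux_one_sub_pos (Nat.prime_of_mem_primeFactors hp)).le
  · exact fun p _ _ => aux_one_sub_le

lemma aux_prod_w (g d : ℕ) (hg : g ≠ 0) (hd : d ≠ 0) (c : ℤ) (hc : c.natAbs = d) :
    ∏ p ∈ g.primeFactors, auxw c p = auxrho g * (auxrho (g * d) / auxrho d) := by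
  rw [auxrho_mul g d hg hd, mul_div_cancel_left₀ _ (auxrho_pos d).ne', auxrho, Finset.prod_filter,
    ← Finset.prod_mul_distrib]
  refine Finset.prod_congr rfl fun p _ => ?_
  unfold auxw
  have : (p : ℤ) ∣ c ↔ p ∣ d := by rw [← hc, Int.natCast_dvd]
  by_cases h : p ∣ d
  · simp [h, this]
  · simp [h, this, sq]

lemma aux_tot_gcd (g u v : ℕ) (hg : 0 < g) (huv : u.Coprime v) :
    (g.totient : ℝ) * (g * (u * v)).totient = (g * u).totient * (g * v).totient := by
  have h1 := Nat.totient_gcd_mul_totient_mul (g * u) (g * v)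
  rw [Nat.gcd_mul_left, huv.gcd_eq_one, mul_one] at h1
  have h2 := Nat.totient_gcd_mul_totient_mul g (g * (u * v))
  rw [Nat.gcd_eq_left (dvd_mul_right _ _)] at h2
  have h3 : g * u * (g * v) = g * (g * (u * v)) := by ring
  rw [h3] at h1
  have h4 := h2.symm.trans h1
  have h5 := Nat.eq_of_mul_eq_mul_right hg h4
  exact_mod_cast h5

def auxPairs (m n : ℕ) : Finset (ℕ × ℕ) :=
  ((Icc 1 m).filter (fun a => Nat.Coprime a m)) ×ˢ ((Icc 1 n).filter (fun a => Nat.Coprime a n))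

def auxNu (g u v : ℕ) (c : ℤ) : Finset (ℕ × ℕ) :=
  (auxPairs (g * u) (g * v)).filter
    (fun q => ((g * u * v : ℕ) : ℤ) ∣ (q.1 : ℤ) * v - q.2 * u - c)

lemma aux_unique {m a a' : ℕ} (ha : a ∈ Icc 1 m) (ha' : a' ∈ Icc 1 m)
    (h : (m : ℤ) ∣ (a : ℤ) - a') : a = a' := by
  rw [Finset.mem_Icc] at ha ha'
  have := Int.eq_zero_of_abs_lt_dvd h (by rw [abs_lt]; constructor <;> omega)
  omega

lemma aux_isUnit {g a : ℕ} (h : a.Coprime g) : IsUnit ((a : ℤ) : ZMod g) := by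
  rw [Int.cast_natCast]
  exact (ZMod.isUnit_iff_coprime a g).2 h

lemma auxNu_le_A (g u v : ℕ) (hg : 0 < g) (hu : 0 < u) (hv : 0 < v) (huv : u.Coprime v) (c : ℤ)
    (x y : ℕ) (hxy : (x, y) ∈ auxNu g u v c) :
    (auxNu g u v c).card ≤ auxA x y u v g := by
  classical
  have : NeZero g := ⟨hg.ne'⟩
  have hu0 : (u : ℤ) ≠ 0 := by exact_mod_cast hu.ne'
  have hv0 : (v : ℤ) ≠ 0 := by exact_mod_cast hv.ne'
  have huvZ : IsCoprime (u : ℤ) v := Nat.isCoprime_iff_coprime.2 huv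
  have hxy' := (Finset.mem_filter.1 hxy).2
  simp only at hxy'
  have key : ∀ q ∈ auxNu g u v c, ∃ α β : ℤ, (q.1 : ℤ) = x + u * α ∧ (q.2 : ℤ) = y + v * β ∧
      (g : ℤ) ∣ α - β := by
    intro q hq
    have hq' := (Finset.mem_filter.1 hq).2
    have hd := dvd_sub hq' hxy'
    have e : (q.1 : ℤ) * v - q.2 * u - c - ((x : ℤ) * v - y * u - c)
      = (q.1 - x) * v - (q.2 - y) * u := by ring
    rw [e] at hd
    push_cast at hd
    have h1 : (u : ℤ) ∣ (q.1 - x) := by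
      apply huvZ.dvd_of_dvd_mul_right
      have : (u : ℤ) ∣ (q.1 - x) * v - (q.2 - y) * u :=
        dvd_trans ⟨g * v, by ring⟩ hd
      exact (dvd_sub_left (dvd_mul_left _ _)).1 this
    have h2 : (v : ℤ) ∣ (q.2 - y) := by
      apply huvZ.symm.dvd_of_dvd_mul_right
      have : (v : ℤ) ∣ (q.1 - x) * v - (q.2 - y) * u :=
        dvd_trans ⟨g * u, by ring⟩ hd
      exact (dvd_sub_right (dvd_mul_left _ _)).1 this
    obtain ⟨α, hα⟩ := h1
    obtain ⟨β, hβ⟩ := h2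
    refine ⟨α, β, by linarith, by linarith, ?_⟩
    rw [hα, hβ] at hd
    have e2 : (u : ℤ) * α * v - v * β * u = (α - β) * (u * v) := by ring
    rw [e2, mul_assoc] at hd
    exact Int.dvd_of_mul_dvd_mul_right (mul_ne_zero hu0 hv0) hd
  choose! α β h1 h2 h3 using key
  unfold auxA
  rw [Nat.card_eq_fintype_card, Fintype.card_subtype]
  refine Finset.card_le_card_of_injOn (fun q => ((α q : ℤ) : ZMod g)) ?_ ?_
  · intro q hq
    have hq' := hq
    simp only [Finset.mem_coe, auxNu, auxPairs, Finset.mem_filter, Finset.mem_product] at hq'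
    simp only [Finset.coe_filter, Finset.mem_univ, true_and, Set.mem_ofPred_eq]
    have ha : q.1.Coprime g := hq'.1.1.2.coprime_mul_right_right
    have hb : q.2.Coprime g := hq'.1.2.2.coprime_mul_right_right
    have hαβ : ((α q : ℤ) : ZMod g) = (β q : ℤ) := by
      have := (ZMod.intCast_zmod_eq_zero_iff_dvd _ g).2 (h3 q hq)
      push_cast at this
      exact sub_eq_zero.1 this
    constructor
    · have := aux_isUnit ha
      rw [h1 q hq] at this
      push_cast at this ⊢
      exact this
    · have := aux_isUnit hb
      rw [h2 q hq] at this
      rw [hαβ]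
      push_cast at this ⊢
      exact this
  · intro q hq q' hq' heq
    simp only at heq
    have hq1 := hq
    have hq1' := hq'
    simp only [Finset.mem_coe, auxNu, auxPairs, Finset.mem_filter, Finset.mem_product] at hq1 hq1'
    have hd : (g : ℤ) ∣ α q - α q' := by
      rw [← ZMod.intCast_zmod_eq_zero_iff_dvd]
      push_cast
      rw [heq, sub_self]
    have hd2 : (g : ℤ) ∣ β q - β q' := by
      have := dvd_sub hd (dvd_sub (h3 q hq) (h3 q' hq'))
      have e : α q - α q' - (α q - β q - (α q' - β q')) = β q - β q' := by ring
      rwa [e] at this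
    refine Prod.ext (aux_unique hq1.1.1.1 hq1'.1.1.1 ?_) (aux_unique hq1.1.2.1 hq1'.1.2.1 ?_)
    · rw [h1 q hq, h1 q' hq']
      push_cast
      have e : (x : ℤ) + u * α q - (x + u * α q') = (α q - α q') * u := by ring
      rw [e]
      exact mul_dvd_mul_right hd _
    · rw [h2 q hq, h2 q' hq']
      push_cast
      have e : (y : ℤ) + v * β q - (y + v * β q') = (β q - β q') * v := by ring
      rw [e]
      exact mul_dvd_mul_right hd2 _

lemma auxNu_coprime (g u v : ℕ) (huv : u.Coprime v) (c : ℤ)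
    (x y : ℕ) (hxy : (x, y) ∈ auxNu g u v c) : c.natAbs.Coprime (u * v) := by
  simp only [auxNu, auxPairs, Finset.mem_filter, Finset.mem_product] at hxy
  obtain ⟨⟨⟨-, h1⟩, ⟨-, h2⟩⟩, hd⟩ := hxy
  refine Nat.Coprime.mul_right ?_ ?_
  · refine Nat.Coprime.symm (Nat.coprime_of_dvd fun p hp hpu hpc => ?_)
    have hpu' : (p : ℤ) ∣ u := Int.natCast_dvd_natCast.2 hpu
    have hpc' : (p : ℤ) ∣ c := Int.natCast_dvd.2 hpc
    have h3 : (p : ℤ) ∣ (x : ℤ) * v - y * u - c :=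
      (Int.natCast_dvd_natCast.2 ((hpu.mul_left g).mul_right v)).trans hd
    have h4 : (p : ℤ) ∣ (x : ℤ) * v :=
      (dvd_sub_left (hpu'.mul_left _)).1 ((dvd_sub_left hpc').1 h3)
    have h5 : p ∣ x * v := by exact_mod_cast h4
    rcases (hp.dvd_mul).1 h5 with h | h
    · exact Nat.not_coprime_of_dvd_of_dvd hp.one_lt h (hpu.mul_left g) h1
    · exact Nat.not_coprime_of_dvd_of_dvd hp.one_lt hpu h huv
  · refine Nat.Coprime.symm (Nat.coprime_of_dvd fun p hp hpv hpc => ?_)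
    have hpv' : (p : ℤ) ∣ v := Int.natCast_dvd_natCast.2 hpv
    have hpc' : (p : ℤ) ∣ c := Int.natCast_dvd.2 hpc
    have h3 : (p : ℤ) ∣ (x : ℤ) * v - y * u - c :=
      (Int.natCast_dvd_natCast.2 (hpv.mul_left (g * u))).trans hd
    have h4 : (p : ℤ) ∣ (y : ℤ) * u :=
      (dvd_sub_right (hpv'.mul_left _)).1 ((dvd_sub_left hpc').1 h3)
    have h5 : p ∣ y * u := by exact_mod_cast h4
    rcases (hp.dvd_mul).1 h5 with h | h
    · exact Nat.not_coprime_of_dvd_of_dvd hp.one_lt h (hpv.mul_left g) h2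
    · exact Nat.not_coprime_of_dvd_of_dvd hp.one_lt h hpv huv

lemma auxNu_le (g u v : ℕ) (hg : 0 < g) (hu : 0 < u) (hv : 0 < v) (huv : u.Coprime v) (c : ℤ)
    (hc : c ≠ 0) :
    ((auxNu g u v c).card : ℝ) ≤ if c.natAbs.Coprime (u * v) then
      ((g * u).totient * (g * v).totient : ℝ) / (g * (u * v).totient) *
        ((c.natAbs : ℝ) / c.natAbs.totient) else 0 := by
  rcases (auxNu g u v c).eq_empty_or_nonempty with h | ⟨⟨x, y⟩, hxy⟩
  · rw [h]
    simp only [Finset.card_empty, Nat.cast_zero]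
    split_ifs <;> positivity
  have hcop := auxNu_coprime g u v huv c x y hxy
  rw [if_pos hcop]
  have h1 := auxNu_le_A g u v hg hu hv huv c x y hxy
  have hd : (g : ℤ) ∣ (x : ℤ) * v - y * u - c :=
    (Int.natCast_dvd_natCast.2 (by rw [mul_assoc]; exact dvd_mul_right _ _)).trans
      (Finset.mem_filter.1 hxy).2
  have h2 := auxA_le x y u v c (Nat.isCoprime_iff_coprime.2 huv) g hg hd
  set d := c.natAbs with hdd
  have hd0 : 0 < d := Int.natAbs_pos.2 hc
  have huv0 : 0 < u * v := Nat.mul_pos hu hv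
  rw [aux_prod_w g (u * v * d) hg.ne' (Nat.mul_pos huv0 hd0).ne' _ (by
    rw [Int.natAbs_mul, Int.natAbs_mul]; simp [hdd])] at h2
  have h3 : ((auxNu g u v c).card : ℝ) ≤ auxA x y u v g := by exact_mod_cast h1
  refine h3.trans (h2.trans ?_)
  have e1 : auxrho (g * (u * v * d)) ≤ auxrho (g * (u * v)) := by
    rw [← mul_assoc]
    exact auxrho_mul_le _ _ (Nat.mul_pos hg huv0).ne' hd0.ne'
  have e2 : auxrho (u * v * d) = auxrho (u * v) * auxrho d := by
    have := Nat.totient_mul hcop.symm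
    have h : ((u * v * d).totient : ℝ) = (u * v).totient * d.totient := by exact_mod_cast this
    rw [aux_tot, aux_tot, aux_tot] at h
    have h0 : ((u * v * d : ℕ) : ℝ) ≠ 0 := by exact_mod_cast (Nat.mul_pos huv0 hd0).ne'
    apply mul_left_cancel₀ h0
    rw [h]; push_cast; ring
  rw [← aux_tot_gcd g u v hg huv, aux_tot g, aux_tot (g * (u * v)), aux_tot (u * v), aux_tot d, e2]
  have p1 := auxrho_pos g
  have p2 := auxrho_pos (u * v)
  have p3 := auxrho_pos d
  have q1 : (0 : ℝ) < g := by exact_mod_cast hg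
  have q2 : (0 : ℝ) < d := by exact_mod_cast hd0
  have q3 : (0 : ℝ) < u := by exact_mod_cast hu
  have q4 : (0 : ℝ) < v := by exact_mod_cast hv
  push_cast
  calc (g : ℝ) * (auxrho g * (auxrho (g * (u * v * d)) / (auxrho (u * v) * auxrho d)))
      ≤ (g : ℝ) * (auxrho g * (auxrho (g * (u * v)) / (auxrho (u * v) * auxrho d))) := by
        gcongr
    _ = _ := by field_simp

lemma aux_coe_eq (x y : ℝ) (h : (x : UnitAddCircle) = (y : UnitAddCircle)) : ∃ j : ℤ, x - y = j := by
  have h1 : ((x - y : ℝ) : UnitAddCircle) = 0 := by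
    rw [AddCircle.coe_sub, h, sub_self]
  rw [AddCircle.coe_eq_zero_iff] at h1
  obtain ⟨j, hj⟩ := h1
  exact ⟨j, by rw [← hj]; simp⟩

lemma aux_isOpen (x y : ℝ) : IsOpen ((fun z : ℝ => (z : UnitAddCircle)) '' Set.Ioo x y) :=
  QuotientAddGroup.isOpenMap_coe _ isOpen_Ioo

lemma aux_vol (x y : ℝ) (hxy : y ≤ x + 1) :
    volume ((fun z : ℝ => (z : UnitAddCircle)) '' Set.Ioo x y) = ENNReal.ofReal (y - x) := by
  rw [AddCircle.add_projection_respects_measure 1 x (aux_isOpen x y).measurableSet, ← Real.volume_Ioo]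
  congr 1
  ext z
  constructor
  · rintro ⟨⟨w, hw, hwz⟩, hz1, hz2⟩
    obtain ⟨j, hj⟩ := aux_coe_eq w z hwz
    have h1 : (j : ℝ) < 1 := by rw [← hj]; linarith [hw.2]
    have h2 : (-1 : ℝ) < j := by rw [← hj]; linarith [hw.1]
    have h3 : j = 0 := by
      have h1' : j < 1 := by exact_mod_cast h1
      have h2' : -1 < j := by exact_mod_cast h2
      omega
    rw [h3] at hj
    have : z = w := by push_cast at hj; linarith
    rw [this]; exact hw
  · intro hz
    exact ⟨⟨z, hz, rfl⟩, hz.1, by linarith [hz.2]⟩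

lemma aux_card (m : ℕ) : ((Finset.Icc 1 m).filter (fun a => Nat.Coprime a m)).card = m.totient := by
  rw [← Nat.filter_coprime_Ico_eq_totient m 1]
  congr 1
  ext a
  simp only [Finset.mem_filter, Finset.mem_Icc, Finset.mem_Ico, Nat.coprime_comm]
  constructor <;> rintro ⟨⟨h1, h2⟩, h3⟩ <;> refine ⟨⟨h1, by omega⟩, h3⟩

lemma aux_E_vol (ψ : ℕ → ℝ) (m : ℕ) (hm : 0 < m) (h0 : 0 ≤ ψ m) (h1 : ψ m ≤ 1 / 2) :
    (volume (E ψ m)).toReal = 2 * ψ m * m.totient / m := by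
  have hm' : (1 : ℝ) ≤ m := by exact_mod_cast hm
  have hm0 : (0 : ℝ) < m := by linarith
  unfold E
  rw [measure_biUnion_finset]
  · have : ∀ a ∈ (Finset.Icc 1 m).filter (fun a => Nat.Coprime a m),
        volume ((fun y : ℝ => (y : UnitAddCircle)) '' Set.Ioo (((a : ℝ) - ψ m) / m) (((a : ℝ) + ψ m) / m))
          = ENNReal.ofReal (2 * ψ m / m) := by
      intro a _
      have h2 : ((a : ℝ) + ψ m) / m - ((a : ℝ) - ψ m) / m = 2 * ψ m / m := by ring
      rw [aux_vol, h2]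
      have : 2 * ψ m / m ≤ 1 := by
        rw [div_le_one hm0]; linarith
      linarith
    rw [Finset.sum_congr rfl this, Finset.sum_const, aux_card, nsmul_eq_mul, ENNReal.toReal_mul,
      ENNReal.toReal_ofReal (by positivity)]
    simp only [ENNReal.toReal_natCast]
    ring
  · intro a ha b hb hab
    rw [Function.onFun, Set.disjoint_left]
    rintro _ ⟨x, hx, rfl⟩ ⟨y, hy, hxy⟩
    obtain ⟨j, hj⟩ := aux_coe_eq y x hxy
    apply hab
    simp only [Finset.coe_filter, Set.mem_ofPred_eq] at ha hb
    refine aux_unique ha.1 hb.1 ?_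
    rw [Set.mem_Ioo, div_lt_iff₀ hm0, lt_div_iff₀ hm0] at hx hy
    have e : y * m - x * m = j * m := by rw [← hj]; ring
    have e1 : ((b : ℝ) - a - j * m) < 1 := by linarith [hx.1, hx.2, hy.1, hy.2]
    have e2 : (-1 : ℝ) < ((b : ℝ) - a - j * m) := by linarith [hx.1, hx.2, hy.1, hy.2]
    have e1' : ((b : ℤ) - a - j * m) < 1 := by exact_mod_cast e1
    have e2' : -1 < ((b : ℤ) - a - j * m) := by exact_mod_cast e2
    refine ⟨-j, ?_⟩
    have : (b : ℤ) - a = j * m := by omega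
    linarith
  · intro a _
    exact (aux_isOpen _ _).measurableSet

open Classical in
lemma aux_inter (ψ : ℕ → ℝ) (m n : ℕ) (hm : 0 < m) (hn : 0 < n) (R S : ℝ)
    (hm1 : ψ m ≤ 1 / 2) (hn1 : ψ n ≤ 1 / 2)
    (h0 : 0 ≤ S) (hR1 : ψ m / m ≤ R) (hR2 : ψ n / n ≤ R)
    (hS : ψ m / m ≤ S ∨ ψ n / n ≤ S) :
    (volume (E ψ m ∩ E ψ n)).toReal ≤
      2 * S * ((auxPairs m n).filter (fun q => ∃ j : ℤ, |(q.1 : ℝ) / m - q.2 / n - j| < 2 * R)).card := by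
  have hm' : (1 : ℝ) ≤ m := by exact_mod_cast hm
  have hn' : (1 : ℝ) ≤ n := by exact_mod_cast hn
  set P := (auxPairs m n).filter (fun q => ∃ j : ℤ, |(q.1 : ℝ) / m - q.2 / n - j| < 2 * R) with hP
  set I : ℕ → ℕ → Set UnitAddCircle := fun k a => (fun y : ℝ => (y : UnitAddCircle)) ''
    Set.Ioo (((a : ℝ) - ψ k) / k) (((a : ℝ) + ψ k) / k) with hI
  have hsub : E ψ m ∩ E ψ n ⊆ ⋃ q ∈ P, (I m q.1 ∩ I n q.2) := by
    rintro z ⟨hz1, hz2⟩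
    simp only [E, Set.mem_iUnion] at hz1 hz2
    obtain ⟨a, ha, hza⟩ := hz1
    obtain ⟨b, hb, hzb⟩ := hz2
    simp only [Set.mem_iUnion]
    refine ⟨(a, b), ?_, hza, hzb⟩
    rw [hP, Finset.mem_filter]
    refine ⟨by simp only [auxPairs, Finset.mem_product]; exact ⟨ha, hb⟩, ?_⟩
    obtain ⟨x, hx, hxz⟩ := hza
    obtain ⟨y, hy, hyz⟩ := hzb
    obtain ⟨j, hj⟩ := aux_coe_eq x y (hxz.trans hyz.symm)
    refine ⟨j, ?_⟩
    rw [Set.mem_Ioo, sub_div, add_div] at hx hy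
    rw [abs_lt]
    dsimp only
    constructor <;> linarith [hx.1, hx.2, hy.1, hy.2]
  have hvol : ∀ k a : ℕ, (1 : ℝ) ≤ k → ψ k ≤ 1 / 2 → ψ k / k ≤ S → volume (I k a) ≤ ENNReal.ofReal (2 * S) := by
    intro k a hk h1 h2
    have h2' : ((a : ℝ) + ψ k) / k - ((a : ℝ) - ψ k) / k = 2 * (ψ k / k) := by ring
    rw [hI]
    dsimp only
    rw [aux_vol, h2']
    · exact ENNReal.ofReal_le_ofReal (by linarith)
    · have : ψ k / k ≤ 1 / 2 := by
        rw [div_le_iff₀ (by linarith)]; linarith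
      linarith
  have hle : volume (E ψ m ∩ E ψ n) ≤ ENNReal.ofReal (2 * S * P.card) := by
    calc volume (E ψ m ∩ E ψ n) ≤ volume (⋃ q ∈ P, (I m q.1 ∩ I n q.2)) := measure_mono hsub
      _ ≤ ∑ q ∈ P, volume (I m q.1 ∩ I n q.2) := measure_biUnion_finset_le _ _
      _ ≤ ∑ q ∈ P, ENNReal.ofReal (2 * S) := by
          refine Finset.sum_le_sum fun q _ => ?_
          rcases hS with h | h
          · exact (measure_mono Set.inter_subset_left).trans (hvol m q.1 hm' hm1 h)
          · exact (measure_mono Set.inter_subset_right).trans (hvol n q.2 hn' hn1 h)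
      _ = ENNReal.ofReal (2 * S * P.card) := by
          rw [Finset.sum_const, nsmul_eq_mul, mul_comm,
            ENNReal.ofReal_mul (p := 2 * S) (by positivity), ENNReal.ofReal_natCast]
  exact ENNReal.toReal_le_of_le_ofReal (by positivity) hle

open Classical in
lemma aux_count (g u v : ℕ) (hg : 0 < g) (hu : 0 < u) (hv : 0 < v) (huv : u.Coprime v)
    (hne : u ≠ v) (δ : ℝ) (hδ : 0 < δ) :
    (((auxPairs (g * u) (g * v)).filter (fun q => ∃ j : ℤ,
      |(q.1 : ℝ) / ((g * u : ℕ) : ℝ) - q.2 / ((g * v : ℕ) : ℝ) - j| < δ)).card : ℝ) ≤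
      2 * (((g*u).totient*(g*v).totient:ℝ)/(g*(u*v).totient)) * auxG (u * v) ⌊δ * (g * u * v : ℕ)⌋₊ := by
  set P := (auxPairs (g * u) (g * v)).filter (fun q => ∃ j : ℤ,
      |(q.1 : ℝ) / ((g * u : ℕ) : ℝ) - q.2 / ((g * v : ℕ) : ℝ) - j| < δ) with hP
  set N := ⌊δ * (g * u * v : ℕ)⌋₊ with hN
  set A := (((g*u).totient*(g*v).totient:ℝ)/(g*(u*v).totient)) with hA
  have hg' : (0 : ℝ) < g := by exact_mod_cast hg
  have hu' : (0 : ℝ) < u := by exact_mod_cast hu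
  have hv' : (0 : ℝ) < v := by exact_mod_cast hv
  have hsub : P ⊆ (Ioc 0 N).biUnion (fun c => auxNu g u v (c : ℤ) ∪ auxNu g u v (-(c : ℤ))) := by
    intro q hq
    rw [hP, Finset.mem_filter] at hq
    obtain ⟨hq1, j, hj⟩ := hq
    set c : ℤ := (q.1 : ℤ) * v - q.2 * u - j * (g * u * v : ℕ) with hc
    have hmem : q ∈ auxNu g u v c := by
      rw [auxNu, Finset.mem_filter]
      refine ⟨hq1, j, ?_⟩
      rw [hc]; ring
    have hc0 : c ≠ 0 := by
      intro h0
      have := auxNu_coprime g u v huv c q.1 q.2 hmem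
      rw [h0, Int.natAbs_zero, Nat.coprime_zero_left, mul_eq_one] at this
      omega
    have hcr : ((c : ℤ) : ℝ) = ((q.1 : ℝ) / ((g * u : ℕ) : ℝ) - q.2 / ((g * v : ℕ) : ℝ) - j) * (g * u * v : ℕ) := by
      rw [hc]; push_cast; field_simp
    have hcabs : (c.natAbs : ℝ) ≤ δ * (g * u * v : ℕ) := by
      rw [Nat.cast_natAbs, Int.cast_abs, hcr, abs_mul, Nat.abs_cast]
      exact mul_le_mul_of_nonneg_right hj.le (Nat.cast_nonneg _)
    rw [Finset.mem_biUnion]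
    refine ⟨c.natAbs, ?_, ?_⟩
    · rw [Finset.mem_Ioc]
      exact ⟨Int.natAbs_pos.mpr hc0, Nat.le_floor hcabs⟩
    · rw [Finset.mem_union]
      rcases Int.natAbs_eq c with h | h
      · left; rw [← h]; exact hmem
      · right; rw [← h]; exact hmem
  have h1 : (P.card : ℝ) ≤ ∑ c ∈ Ioc 0 N, (((auxNu g u v (c : ℤ)).card : ℝ) + (auxNu g u v (-(c : ℤ))).card) := by
    have := (Finset.card_le_card hsub).trans (Finset.card_biUnion_le)
    have h2 := this.trans (Finset.sum_le_sum fun c _ => Finset.card_union_le (auxNu g u v (c : ℤ)) (auxNu g u v (-(c : ℤ))))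
    exact_mod_cast h2
  refine h1.trans ?_
  rw [auxG, Finset.sum_filter, Finset.mul_sum]
  refine Finset.sum_le_sum fun c hc => ?_
  have hc1 : 0 < c := (Finset.mem_Ioc.mp hc).1
  have e1 := auxNu_le g u v hg hu hv huv (c : ℤ) (by omega)
  have e2 := auxNu_le g u v hg hu hv huv (-(c : ℤ)) (by omega)
  rw [Int.natAbs_neg] at e2
  rw [Int.natAbs_natCast] at e1 e2
  split_ifs at e1 e2 ⊢ with h
  · calc _ ≤ _ := add_le_add e1 e2
      _ = _ := by rw [hA]; ring
  · linarith

/-- Averaged overlap estimate, rescaled form: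
`∑_{k=1}^K e^{2k} λ(E_m^{(k)} ∩ E_n^{(k)}) ≪ K λ(E_m) λ(E_n)`. -/
theorem averaged_overlap_rescaled (ε : ℝ) (hε : 0 < ε) :
    ∃ C : ℝ, 0 < C ∧ ∀ (h : ℕ), 1 ≤ h → ∀ (m n : ℕ),
      2 ^ 4 ^ h ≤ m → m < n → n < 2 ^ 4 ^ (h + 1) →
      ∀ (ψ : ℕ → ℝ), (∀ j, 0 ≤ ψ j) →
      1 / (m : ℝ) ≤ ψ m → ψ m ≤ 1 / 2 → 1 / (n : ℝ) ≤ ψ n → ψ n ≤ 1 / 2 →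
      ∑ k ∈ Finset.Icc 1 ⌊ε * h * Real.log 4⌋₊,
          Real.exp (2 * k) *
            (volume (E (Function.update (Function.update ψ m (ψ m / Real.exp k)) n
                (ψ n / Real.exp k)) m ∩
              E (Function.update (Function.update ψ m (ψ m / Real.exp k)) n
                (ψ n / Real.exp k)) n)).toReal ≤
        C * ⌊ε * h * Real.log 4⌋₊ * (volume (E ψ m)).toReal * (volume (E ψ n)).toReal := by
  obtain ⟨C1, hC1, havg⟩ := aux_avg
  obtain ⟨C2, hC2, htail⟩ := aux_V_tail ε hε
  refine ⟨2 * C1 * C2, by positivity, ?_⟩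
  intro h hh m n hm hmn hn ψ hψ hm0 hm1 hn0 hn1
  set K := ⌊ε * h * Real.log 4⌋₊ with hK
  rcases Nat.eq_zero_or_pos K with hK0 | hKpos
  · rw [hK0]; simp
  have hmpos : 0 < m := lt_of_lt_of_le (by positivity) hm
  have hnpos : 0 < n := hmpos.trans hmn
  have hmR : (0 : ℝ) < m := by exact_mod_cast hmpos
  have hnR : (0 : ℝ) < n := by exact_mod_cast hnpos
  have hψm : 0 < ψ m := lt_of_lt_of_le (by positivity) hm0
  have hψn : 0 < ψ n := lt_of_lt_of_le (by positivity) hn0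
  rw [aux_E_vol ψ m hmpos hψm.le hm1, aux_E_vol ψ n hnpos hψn.le hn1]
  obtain ⟨g, u, v, hg, huv, hmu, hnv⟩ : ∃ g u v : ℕ, 0 < g ∧ u.Coprime v ∧ m = g * u ∧ n = g * v := by
    obtain ⟨u, v, huv, h1, h2⟩ := Nat.exists_coprime m n
    exact ⟨m.gcd n, u, v, Nat.gcd_pos_of_pos_left _ hmpos, huv, by rw [mul_comm]; exact h1,
      by rw [mul_comm]; exact h2⟩
  have hu : 0 < u := Nat.pos_of_mul_pos_left (hmu ▸ hmpos)
  have hv : 0 < v := Nat.pos_of_mul_pos_left (hnv ▸ hnpos)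
  have hne : u ≠ v := by
    rintro rfl
    omega
  have hgR : (0 : ℝ) < g := by exact_mod_cast hg
  have huR : (0 : ℝ) < u := by exact_mod_cast hu
  have hvR : (0 : ℝ) < v := by exact_mod_cast hv
  have ht : u * v < 2 ^ (8 * 4 ^ h) := by
    have e1 : u ≤ m := hmu ▸ Nat.le_mul_of_pos_left u hg
    have e2 : v ≤ n := hnv ▸ Nat.le_mul_of_pos_left v hg
    have e3 : 2 ^ (8 * 4 ^ h) = 2 ^ 4 ^ (h + 1) * 2 ^ 4 ^ (h + 1) := by
      rw [← pow_add]; congr 1; ring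
    rw [e3]
    exact Nat.mul_lt_mul'' (by omega) (by omega)
  have htpos : 0 < u * v := by positivity
  have hφt : (0 : ℝ) < (u * v).totient := by exact_mod_cast Nat.totient_pos.mpr htpos
  have hV := htail h (u * v) htpos ht hKpos
  rw [← hK] at hV
  set R := max (ψ m / m) (ψ n / n) with hR
  set S := min (ψ m / m) (ψ n / n) with hS
  have hRS : R * S = (ψ m / m) * (ψ n / n) := max_mul_min _ _
  have hRpos : 0 < R := lt_max_of_lt_left (by positivity)
  have hSpos : 0 < S := lt_min (by positivity) (by positivity)
  set A := (((g*u).totient*(g*v).totient:ℝ)/(g*(u*v).totient)) with hA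
  have hA0 : 0 ≤ A := by positivity
  set X : ℝ := 2 * R * (g * u * v : ℕ) with hX
  have hL : (0 : ℝ) < (g * u * v : ℕ) := by push_cast; positivity
  have hXpos : 0 < X := by positivity
  have hterm : ∀ k ∈ Finset.Icc 1 K, Real.exp (2 * k) *
            (volume (E (Function.update (Function.update ψ m (ψ m / Real.exp k)) n
                (ψ n / Real.exp k)) m ∩
              E (Function.update (Function.update ψ m (ψ m / Real.exp k)) n
                (ψ n / Real.exp k)) n)).toReal ≤
          (4 * S * A * X) * (Real.exp k / X * auxG (u * v) ⌊X / Real.exp k⌋₊) := by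
    intro k _
    have hek : (0 : ℝ) < Real.exp k := Real.exp_pos _
    have hek1 : (1 : ℝ) ≤ Real.exp k := Real.one_le_exp (Nat.cast_nonneg k)
    set ψ' := Function.update (Function.update ψ m (ψ m / Real.exp k)) n (ψ n / Real.exp k) with hψ'
    have e1 : ψ' n = ψ n / Real.exp k := by rw [hψ', Function.update_self]
    have e2 : ψ' m = ψ m / Real.exp k := by
      rw [hψ', Function.update_of_ne hmn.ne, Function.update_self]
    have e3 : ψ' m / m = (ψ m / m) / Real.exp k := by rw [e2]; ring
    have e4 : ψ' n / n = (ψ n / n) / Real.exp k := by rw [e1]; ring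
    have hI := aux_inter ψ' m n hmpos hnpos (R / Real.exp k) (S / Real.exp k)
      (by rw [e2]; exact (div_le_self hψm.le hek1).trans hm1)
      (by rw [e1]; exact (div_le_self hψn.le hek1).trans hn1) (by positivity)
      (by rw [e3]; exact div_le_div_of_nonneg_right (le_max_left _ _) hek.le)
      (by rw [e4]; exact div_le_div_of_nonneg_right (le_max_right _ _) hek.le)
      (by
        rw [e3, e4]
        rcases min_choice (ψ m / m) (ψ n / n) with h1 | h1
        · left; rw [hS, h1]
        · right; rw [hS, h1])
    have hcnt := aux_count g u v hg hu hv huv hne (2 * (R / Real.exp k)) (by positivity)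
    rw [← hmu, ← hnv] at hcnt
    have e5 : 2 * (R / Real.exp k) * (m * v : ℕ) = X / Real.exp k := by rw [hX, ← hmu]; ring
    rw [e5] at hcnt
    have e6 : Real.exp (2 * k) = Real.exp k * Real.exp k := by rw [← Real.exp_add]; congr 1; ring
    rw [e6]
    refine (mul_le_mul_of_nonneg_left (hI.trans (mul_le_mul_of_nonneg_left hcnt (by positivity)))
      (by positivity)).trans (le_of_eq ?_)
    rw [hA, ← hmu, ← hnv]
    field_simp
    ring
  refine (Finset.sum_le_sum hterm).trans ?_
  rw [← Finset.mul_sum]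
  have hfin := havg (u * v) K X hKpos hXpos
  have hfin2 : ∑ k ∈ Icc 1 K, Real.exp k / X * auxG (u * v) ⌊X / Real.exp k⌋₊
      ≤ C1 * K * (C2 * ((u * v).totient / (u * v : ℕ))) :=
    hfin.trans (mul_le_mul_of_nonneg_left hV (by positivity))
  refine (mul_le_mul_of_nonneg_left hfin2 (by positivity)).trans (le_of_eq ?_)
  have e7 : 4 * S * A * X = 8 * ((ψ m / m) * (ψ n / n)) * A * ((g : ℝ) * (u * v)) := by
    rw [← hRS, hX]; push_cast; ring
  rw [e7, hA, ← hmu, ← hnv]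
  push_cast
  field_simp
  ring
end
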